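/- arXiv:1308.1620 — 6 statements merged into one kernel-verified Lean document; each statement's English description precedes it below -/
import Mathlib

section
/- Let α be a real number with 0 < α < 1 and let k be an integer with k > 16^(1/α). Then there exists an infinite word z : ℕ → Fin k over an alphabet of size k whose similarity coefficient is at most α; that is, for every t ≥ 0, every ℓ ≥ 1, and every list w that is a common subsequence of the two adjacent factors z(t)z(t+1)⋯z(t+ℓ−1) and z(t+ℓ)z(t+ℓ+1)⋯z(t+2ℓ−1), the length of w is at most α·ℓ. -/
open Finset

/-- The finite set of all words of length `n`. -/
noncomputable def wordsOfLength (β : Type*) [Fintype β] (n : ℕ) : Finset (List β) :=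
  (List.finite_length_eq β n).toFinset

@[simp]
theorem mem_wordsOfLength {β : Type*} [Fintype β] {n : ℕ} {w : List β} :
    w ∈ wordsOfLength β n ↔ w.length = n := by
  simp [wordsOfLength]

theorem wordsOfLength_succ (β : Type*) [Fintype β] [DecidableEq β] (n : ℕ) :
    wordsOfLength β (n + 1) =
      (univ ×ˢ wordsOfLength β n).image fun p : β × List β => p.1 :: p.2 := by
  ext w
  cases w <;> simp

theorem card_image_cons {β : Type*} [Fintype β] [DecidableEq β] (s : Finset (List β)) :
    ((univ ×ˢ s).image fun p : β × List β => p.1 :: p.2).card = Fintype.card β * s.card := by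
  rw [card_image_of_injective, card_product, card_univ]
  rintro ⟨a, u⟩ ⟨b, v⟩ h
  simpa using h

theorem card_wordsOfLength (β : Type*) [Fintype β] (n : ℕ) :
    (wordsOfLength β n).card = Fintype.card β ^ n := by
  classical
  induction n with
  | zero =>
    have : wordsOfLength β 0 = {[]} := by ext w; simp
    simp [this]
  | succ n ih => rw [wordsOfLength_succ, card_image_cons, ih, pow_succ']

open Classical in
/-- At most `C(n, |u|) * |β| ^ (n - |u|)` words of length `n` contain `u` as a subsequence. -/
theorem card_filter_sublist_mul_pow_le {β : Type*} [Fintype β] (u : List β) (n : ℕ) :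
    {x ∈ wordsOfLength β n | u.Sublist x}.card * Fintype.card β ^ u.length ≤
      n.choose u.length * Fintype.card β ^ n := by
  induction n generalizing u with
  | zero =>
    cases u with
    | nil => simp [card_wordsOfLength]
    | cons a u =>
      have : {x ∈ wordsOfLength β 0 | (a :: u).Sublist x} = ∅ := by
        ext w; cases w <;> simp
      simp [this]
  | succ n ih =>
    cases u with
    | nil => simp [card_wordsOfLength]
    | cons a u =>
      have hsub : {x ∈ wordsOfLength β (n + 1) | (a :: u).Sublist x} ⊆
          ((univ ×ˢ {x ∈ wordsOfLength β n | (a :: u).Sublist x}).image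
            fun p : β × List β => p.1 :: p.2) ∪
          {x ∈ wordsOfLength β n | u.Sublist x}.image (List.cons a) := by
        intro w hw
        simp only [mem_filter, mem_wordsOfLength] at hw
        obtain ⟨hl, hs⟩ := hw
        cases w with
        | nil => simp at hl
        | cons b w =>
          simp only [List.length_cons, add_left_inj] at hl
          rcases List.cons_sublist_cons'.1 hs with h | ⟨rfl, h⟩
          · simp [hl, h]
          · simp [hl, h]
      have hcard := (card_le_card hsub).trans (card_union_le _ _)
      rw [card_image_cons] at hcard
      have hcard' := hcard.trans (Nat.add_le_add_left card_image_le _)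
      have h₁ := ih (a :: u)
      have h₂ := ih u
      rw [List.length_cons] at h₁ ⊢
      rw [Nat.choose_succ_succ]
      calc _ ≤ _ := Nat.mul_le_mul_right _ hcard'
        _ = Fintype.card β * ({x ∈ wordsOfLength β n | (a :: u).Sublist x}.card *
              Fintype.card β ^ (u.length + 1)) +
            Fintype.card β * ({x ∈ wordsOfLength β n | u.Sublist x}.card *
              Fintype.card β ^ u.length) := by ring
        _ ≤ Fintype.card β * (n.choose (u.length + 1) * Fintype.card β ^ n) +
            Fintype.card β * (n.choose u.length * Fintype.card β ^ n) := by gcongr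
        _ = _ := by rw [Nat.succ_eq_add_one]; ring

/-- `x` and `y` have a common subsequence of length more than `α * ℓ`. -/
def HasLongCommonSubseq {β : Type*} (α : ℝ) (ℓ : ℕ) (x y : List β) : Prop :=
  ∃ u : List β, u.Sublist x ∧ u.Sublist y ∧ α * ℓ < u.length

open Classical in
/-- If `16 ≤ |β| ^ α`, at most `(|β| / 4) ^ ℓ` words of length `ℓ` are similar to a given one. -/
theorem card_filter_hasLongCommonSubseq_le {β : Type*} [Fintype β] {α : ℝ} (hα : 0 ≤ α)
    (hβ : 1 ≤ Fintype.card β) (hk : (16 : ℝ) ≤ (Fintype.card β : ℝ) ^ α)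
    {ℓ : ℕ} {y : List β} (hy : y.length ≤ ℓ) :
    ({x ∈ wordsOfLength β ℓ | HasLongCommonSubseq α ℓ x y}.card : ℝ) ≤
      ((Fintype.card β : ℝ) / 4) ^ ℓ := by
  set k := Fintype.card β
  set m := ⌊α * ℓ⌋₊ + 1 with hm
  set B := {x ∈ wordsOfLength β ℓ | HasLongCommonSubseq α ℓ x y}
  have hsub : B ⊆ (y.sublistsLen m).toFinset.biUnion
      fun u => {x ∈ wordsOfLength β ℓ | u.Sublist x} := by
    intro x hx
    obtain ⟨hl, u, hux, huy, hu⟩ := mem_filter.1 hx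
    have hmu : m ≤ u.length := Nat.succ_le_of_lt ((Nat.floor_lt (by positivity)).2 hu)
    simp only [mem_biUnion, List.mem_toFinset, List.mem_sublistsLen, mem_filter]
    exact ⟨u.take m, ⟨(List.take_sublist _ _).trans huy, by simp [hmu]⟩, hl,
      (List.take_sublist _ _).trans hux⟩
  have hnat : B.card * k ^ m ≤ 4 ^ ℓ * k ^ ℓ := by
    calc B.card * k ^ m
        ≤ (∑ u ∈ (y.sublistsLen m).toFinset,
            {x ∈ wordsOfLength β ℓ | u.Sublist x}.card) * k ^ m :=
          Nat.mul_le_mul_right _ ((card_le_card hsub).trans card_biUnion_le)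
      _ = ∑ u ∈ (y.sublistsLen m).toFinset,
            {x ∈ wordsOfLength β ℓ | u.Sublist x}.card * k ^ m := sum_mul _ _ _
      _ ≤ ∑ u ∈ (y.sublistsLen m).toFinset, 2 ^ ℓ * k ^ ℓ := by
          refine sum_le_sum fun u hu => ?_
          have hu' := (List.mem_sublistsLen.1 (List.mem_toFinset.1 hu)).2
          have h := card_filter_sublist_mul_pow_le u ℓ
          rw [hu'] at h
          exact h.trans (Nat.mul_le_mul_right _ (Nat.choose_le_two_pow _ _))
      _ ≤ 2 ^ ℓ * (2 ^ ℓ * k ^ ℓ) := by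
          rw [sum_const, smul_eq_mul]
          refine Nat.mul_le_mul_right _ ((List.toFinset_card_le _).trans ?_)
          rw [List.length_sublistsLen]
          exact (Nat.choose_le_two_pow _ _).trans (Nat.pow_le_pow_right (by norm_num) hy)
      _ = 4 ^ ℓ * k ^ ℓ := by
          rw [← mul_assoc, ← mul_pow]; norm_num
  have hpow : (16 : ℝ) ^ ℓ ≤ (k : ℝ) ^ m := by
    have h1 : (1 : ℝ) ≤ k := by exact_mod_cast hβ
    calc (16 : ℝ) ^ ℓ ≤ ((k : ℝ) ^ α) ^ ℓ := by gcongr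
      _ = (k : ℝ) ^ (α * ℓ) := by rw [Real.rpow_mul (by positivity), Real.rpow_natCast]
      _ ≤ (k : ℝ) ^ (m : ℝ) := by
          refine Real.rpow_le_rpow_of_exponent_le h1 ?_
          rw [hm]; push_cast
          exact (Nat.lt_floor_add_one _).le
      _ = (k : ℝ) ^ m := Real.rpow_natCast _ _
  have hreal : (B.card : ℝ) * (k : ℝ) ^ m ≤ 4 ^ ℓ * (k : ℝ) ^ ℓ := by exact_mod_cast hnat
  have h16 : (B.card : ℝ) * 16 ^ ℓ ≤ 4 ^ ℓ * (k : ℝ) ^ ℓ :=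
    (mul_le_mul_of_nonneg_left hpow (by positivity)).trans hreal
  rw [div_pow, le_div_iff₀ (by positivity)]
  have h4 : (16 : ℝ) ^ ℓ = 4 ^ ℓ * 4 ^ ℓ := by rw [← mul_pow]; norm_num
  rw [h4] at h16
  have : (0 : ℝ) < 4 ^ ℓ := by positivity
  nlinarith

/-- A finite word in which adjacent factors of equal length `ℓ` have no common subsequence of
length more than `α * ℓ`. -/
def AvoidsSimilarSquares {β : Type*} (α : ℝ) (w : List β) : Prop :=
  ∀ x y : List β, (x ++ y).IsInfix w → x.length = y.length →
    ¬ HasLongCommonSubseq α x.length x y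

theorem AvoidsSimilarSquares.of_isInfix {β : Type*} {α : ℝ} {v w : List β}
    (hw : AvoidsSimilarSquares α w) (h : v.IsInfix w) : AvoidsSimilarSquares α v :=
  fun x y hxy => hw x y (hxy.trans h)

open Classical in
/-- The words of length `n` that avoid `α`-similar squares. -/
noncomputable def avoidingWords (β : Type*) [Fintype β] (α : ℝ) (n : ℕ) : Finset (List β) :=
  {w ∈ wordsOfLength β n | AvoidsSimilarSquares α w}

open Classical in
/-- The words of length `ℓ + n` starting with an `α`-similar square of period `ℓ`, and whose
suffix of length `n` avoids `α`-similar squares. -/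
noncomputable def wordsStartingWithSimilarSquare (β : Type*) [Fintype β] (α : ℝ) (ℓ n : ℕ) :
    Finset (List β) :=
  (avoidingWords β α n).biUnion fun v =>
    {x ∈ wordsOfLength β ℓ | HasLongCommonSubseq α ℓ x (v.take ℓ)}.image (· ++ v)

theorem card_wordsStartingWithSimilarSquare_le {β : Type*} [Fintype β] {α : ℝ} (hα : 0 ≤ α)
    (hβ : 1 ≤ Fintype.card β) (hk : (16 : ℝ) ≤ (Fintype.card β : ℝ) ^ α) (ℓ n : ℕ) :
    ((wordsStartingWithSimilarSquare β α ℓ n).card : ℝ) ≤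
      ((Fintype.card β : ℝ) / 4) ^ ℓ * (avoidingWords β α n).card := by
  classical
  calc ((wordsStartingWithSimilarSquare β α ℓ n).card : ℝ)
      ≤ ∑ v ∈ avoidingWords β α n,
          ({x ∈ wordsOfLength β ℓ | HasLongCommonSubseq α ℓ x (v.take ℓ)}.card : ℝ) := by
        exact_mod_cast card_biUnion_le.trans (sum_le_sum fun v _ => card_image_le)
    _ ≤ ∑ v ∈ avoidingWords β α n, ((Fintype.card β : ℝ) / 4) ^ ℓ :=
        sum_le_sum fun v _ => card_filter_hasLongCommonSubseq_le hα hβ hk (by simp)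
    _ = _ := by rw [sum_const, nsmul_eq_mul, mul_comm]

open Classical in
/-- Prepending a letter to an avoiding word gives an avoiding word or creates a similar square
at the start. -/
theorem image_cons_avoidingWords_subset {β : Type*} [Fintype β] {α : ℝ} (n : ℕ) :
    ((univ ×ˢ avoidingWords β α n).image fun p : β × List β => p.1 :: p.2) ⊆
      avoidingWords β α (n + 1) ∪
        (range (n + 1)).biUnion fun i => wordsStartingWithSimilarSquare β α (i + 1) (n - i) := by
  intro v hv
  simp only [avoidingWords, mem_image, mem_product, mem_univ, true_and, mem_filter,
    mem_wordsOfLength, Prod.exists] at hv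
  obtain ⟨a, w, ⟨hl, hw⟩, rfl⟩ := hv
  by_cases hgood : AvoidsSimilarSquares α (a :: w)
  · simp [avoidingWords, hl, hgood]
  refine mem_union_right _ ?_
  simp only [AvoidsSimilarSquares, not_forall, not_not] at hgood
  obtain ⟨x, y, hxy, hlen, hsim⟩ := hgood
  rcases List.infix_cons_iff.1 hxy with ⟨r, hr⟩ | h
  · cases x with
    | nil =>
      obtain ⟨u, hu, -, hlt⟩ := hsim
      simp [List.sublist_nil.1 hu] at hlt
    | cons b x =>
      simp only [List.cons_append, List.cons.injEq] at hr
      obtain ⟨rfl, hr⟩ := hr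
      have hr' : x ++ (y ++ r) = w := by simpa using hr
      have hln : x.length + (y ++ r).length = n := by rw [← hl, ← hr', ← List.length_append]
      have hgood : AvoidsSimilarSquares α (y ++ r) :=
        hw.of_isInfix (hr' ▸ (List.suffix_append x (y ++ r)).isInfix)
      simp only [mem_biUnion, mem_range, wordsStartingWithSimilarSquare, avoidingWords,
        mem_filter, mem_wordsOfLength, mem_image]
      refine ⟨x.length, by omega, y ++ r, ⟨by omega, hgood⟩, b :: x, ⟨by simp, ?_⟩, ?_⟩
      · rw [← List.length_cons (a := b), hlen, List.take_left, ← hlen]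
        exact hsim
      · rw [List.cons_append, hr']
  · exact absurd hsim (hw x y h hlen)

/-- The number of avoiding words grows at least by a factor `|β| / 2` with each letter. -/
theorem card_avoidingWords_succ_ge {β : Type*} [Fintype β] {α : ℝ} (hα : 0 ≤ α)
    (hβ : 1 ≤ Fintype.card β) (hk : (16 : ℝ) ≤ (Fintype.card β : ℝ) ^ α) (n : ℕ) :
    (Fintype.card β : ℝ) / 2 * (avoidingWords β α n).card ≤
      (avoidingWords β α (n + 1)).card := by
  classical
  induction n using Nat.strong_induction_on with
  | _ n ih =>
    set k : ℝ := (Fintype.card β : ℝ) with hkdef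
    set c : ℕ → ℝ := fun j => (avoidingWords β α j).card
    have hkpos : 0 < k := by rw [hkdef]; exact_mod_cast hβ
    have hgrow : ∀ i ≤ n, (k / 2) ^ i * c (n - i) ≤ c n := by
      intro i
      induction i with
      | zero => simp
      | succ i ihi =>
        intro hi
        have h := ih (n - (i + 1)) (by omega)
        rw [show n - (i + 1) + 1 = n - i by omega] at h
        calc (k / 2) ^ (i + 1) * c (n - (i + 1))
            = (k / 2) ^ i * (k / 2 * c (n - (i + 1))) := by ring
          _ ≤ (k / 2) ^ i * c (n - i) := by gcongr
          _ ≤ c n := ihi (by omega)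
    have hcount : k * c n ≤ c (n + 1) +
        ∑ i ∈ range (n + 1), ((wordsStartingWithSimilarSquare β α (i + 1) (n - i)).card : ℝ) := by
      have h := (card_le_card (image_cons_avoidingWords_subset (β := β) (α := α) n)).trans
        ((card_union_le _ _).trans (Nat.add_le_add_left card_biUnion_le _))
      rw [card_image_cons] at h
      rw [hkdef]
      simp only [c]
      exact_mod_cast h
    have hbad : ∀ i ∈ range (n + 1),
        ((wordsStartingWithSimilarSquare β α (i + 1) (n - i)).card : ℝ) ≤
          k / 4 * c n * (1 / 2) ^ i := by
      intro i hi
      refine (card_wordsStartingWithSimilarSquare_le hα hβ hk _ _).trans ?_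
      calc (k / 4) ^ (i + 1) * c (n - i)
          = k / 4 * (1 / 2) ^ i * ((k / 2) ^ i * c (n - i)) := by
            rw [pow_succ, show k / 4 = 1 / 2 * (k / 2) by ring, mul_pow]; ring
        _ ≤ k / 4 * (1 / 2) ^ i * c n := by
            gcongr
            exact hgrow i (by simpa [Nat.lt_succ_iff] using hi)
        _ = _ := by ring
    have hsum := sum_le_sum hbad
    rw [← mul_sum] at hsum
    have hgeom : ∑ i ∈ range (n + 1), (1 / 2 : ℝ) ^ i ≤ 2 := sum_geometric_two_le _
    have hcn : 0 ≤ k / 4 * c n := by positivity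
    have := mul_le_mul_of_nonneg_left hgeom hcn
    change k / 2 * c n ≤ c (n + 1)
    linarith

theorem avoidingWords_nonempty {β : Type*} [Fintype β] {α : ℝ} (hα : 0 ≤ α)
    (hβ : 1 ≤ Fintype.card β) (hk : (16 : ℝ) ≤ (Fintype.card β : ℝ) ^ α) (n : ℕ) :
    (avoidingWords β α n).Nonempty := by
  classical
  induction n with
  | zero =>
    refine ⟨[], mem_filter.2 ⟨by simp, fun x y hxy _ ⟨u, hux, _, hlt⟩ => ?_⟩⟩
    obtain ⟨rfl, rfl⟩ := List.append_eq_nil_iff.1 (List.infix_nil.1 hxy)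
    simp [List.sublist_nil.1 hux] at hlt
  | succ n ih =>
    have h := card_avoidingWords_succ_ge hα hβ hk n
    have hpos : (0 : ℝ) < (avoidingWords β α n).card := by exact_mod_cast ih.card_pos
    have hβ' : (0 : ℝ) < Fintype.card β := by exact_mod_cast hβ
    have : (0 : ℝ) < (avoidingWords β α (n + 1)).card := lt_of_lt_of_le (by positivity) h
    exact card_pos.1 (by exact_mod_cast this)

/-- By compactness, a factor-closed property of words over a finite alphabet that holds for words
of every length holds for all prefixes of some infinite word. -/
theorem exists_infinite_word_of_isInfix_closed {β : Type*} [Finite β] [Nonempty β]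
    {P : List β → Prop} (hP : ∀ v w, v.IsInfix w → P w → P v)
    (hex : ∀ n, ∃ w : List β, w.length = n ∧ P w) :
    ∃ z : ℕ → β, ∀ n, P ((List.range n).map z) := by
  let _ : TopologicalSpace β := ⊥
  have : DiscreteTopology β := ⟨rfl⟩
  have hne : (⋂ n, {z : ℕ → β | P ((List.range n).map z)}).Nonempty := by
    have hclosed : ∀ n, IsClosed {z : ℕ → β | P ((List.range n).map z)} := by
      intro n
      have h : Continuous fun (z : ℕ → β) (i : Fin n) => z i := by fun_prop
      convert (isClosed_discrete {f : Fin n → β | P (List.ofFn f)}).preimage h using 1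
      ext z
      have : (List.range n).map z = List.ofFn fun i : Fin n => z i := by
        apply List.ext_getElem <;> simp
      simp [this]
    refine IsCompact.nonempty_iInter_of_sequence_nonempty_isCompact_isClosed _
      (fun n z hz => ?_) (fun n => ?_) (hclosed 0).isCompact hclosed
    · refine hP _ _ ?_ hz
      rw [List.range_succ, List.map_append]
      exact (List.prefix_append _ _).isInfix
    · obtain ⟨w, rfl, hw⟩ := hex n
      refine ⟨fun i => w.getD i (Classical.arbitrary β), ?_⟩
      rw [Set.mem_ofPred_eq]
      convert hw
      apply List.ext_getElem <;> simp +contextual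
  obtain ⟨z, hz⟩ := hne
  exact ⟨z, fun n => Set.mem_iInter.1 hz n⟩


/-- Theorem 1 (main theorem): for `0 < α < 1` and integer `k > 16^(1/α)`, there is an
infinite word over a `k`-letter alphabet with similarity coefficient at most `α`:
every common subsequence of two adjacent equal-length factors of length `ℓ ≥ 1`
has length at most `α·ℓ`. -/
theorem exists_infinite_word_similarity_le
    (α : ℝ) (hα0 : 0 < α) (hα1 : α < 1)
    (k : ℕ) (hk : (16 : ℝ) ^ (1 / α) < (k : ℝ)) :
    ∃ z : ℕ → Fin k,
      ∀ (t ℓ : ℕ), 1 ≤ ℓ →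
        ∀ w : List (Fin k),
          w.Sublist ((List.range ℓ).map fun i => z (t + i)) →
          w.Sublist ((List.range ℓ).map fun i => z (t + ℓ + i)) →
          (w.length : ℝ) ≤ α * ℓ := by
  have hk1 : (1 : ℝ) < k := (Real.one_lt_rpow (by norm_num) (by positivity)).trans hk
  have hkα : (16 : ℝ) ≤ (k : ℝ) ^ α := by
    have h := Real.rpow_le_rpow (by positivity) hk.le hα0.le
    rwa [← Real.rpow_mul (by norm_num), one_div_mul_cancel hα0.ne', Real.rpow_one] at h
  have hk0 : 1 ≤ k := by exact_mod_cast hk1.le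
  have : Nonempty (Fin k) := ⟨⟨0, hk0⟩⟩
  obtain ⟨z, hz⟩ := exists_infinite_word_of_isInfix_closed
    (P := AvoidsSimilarSquares (β := Fin k) α) (fun v w h hw => hw.of_isInfix h) (fun n => by
      classical
      obtain ⟨w, hw⟩ := avoidingWords_nonempty (β := Fin k) hα0.le (by simpa using hk0)
        (by simpa using hkα) n
      obtain ⟨hl, hw⟩ := mem_filter.1 hw
      exact ⟨w, mem_wordsOfLength.1 hl, hw⟩)
  refine ⟨z, fun t ℓ _ w hx hy => ?_⟩
  by_contra! hlt
  refine hz (t + ℓ + ℓ) _ _ ?_ ?_ ⟨w, hx, hy, by simpa using hlt⟩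
  · refine ⟨(List.range t).map z, [], ?_⟩
    simp [List.range_add, Function.comp_def]
  · simp
end

section
/- Let α be a real number with 0 < α < 1, let k be an integer with k > 16^(1/α), and let n be a positive integer. Then there exists a positive integer M such that k^M > ((k^(n+1) − 1)/(k − 1)) · C_M · Σ_{j=⌈αM⌉}^{M} (M choose j)² · k^(M−j), where C_M denotes the M-th Catalan number. -/
open Finset

/-- The Catalan number `C_M` is at most `4 ^ M`. -/
lemma catalan_le_four_pow (M : ℕ) : catalan M ≤ 4 ^ M := by
  rw [catalan_eq_centralBinom_div]
  exact (Nat.div_le_self _ _).trans (Nat.centralBinom_le_four_pow M)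

/-- A partial sum of squared binomial coefficients is at most `4 ^ M`. -/
lemma sum_Icc_choose_sq_le_four_pow (m M : ℕ) :
    ∑ j ∈ Icc m M, M.choose j ^ 2 ≤ 4 ^ M := by
  calc ∑ j ∈ Icc m M, M.choose j ^ 2
      ≤ ∑ j ∈ range (M + 1), M.choose j ^ 2 :=
        sum_le_sum_of_subset fun j hj => by
          rw [mem_Icc] at hj
          rw [mem_range]
          lia
    _ = M.centralBinom := by rw [Nat.sum_range_choose_sq, Nat.centralBinom]
    _ ≤ 4 ^ M := Nat.centralBinom_le_four_pow M

/-- For `j ≥ α M`, the factor `k ^ (M - j)` saves at least `(k ^ α) ^ M` compared to `k ^ M`. -/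
lemma pow_sub_mul_rpow_pow_le {α x : ℝ} (hx : 1 ≤ x) {M j : ℕ}
    (hj : ⌈α * M⌉₊ ≤ j) (hjM : j ≤ M) :
    x ^ (M - j) * (x ^ α) ^ M ≤ x ^ M := by
  have hpow : (x ^ α) ^ M ≤ x ^ j := by
    rw [← Real.rpow_mul_natCast (by positivity), ← Real.rpow_natCast x j]
    exact Real.rpow_le_rpow_of_exponent_le hx (Nat.ceil_le.mp hj)
  calc x ^ (M - j) * (x ^ α) ^ M ≤ x ^ (M - j) * x ^ j := by gcongr
    _ = x ^ M := pow_sub_mul_pow x hjM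

/-- The weighted sum of squared binomial coefficients from `⌈α M⌉` to `M`. -/
lemma sum_choose_sq_mul_pow_mul_rpow_pow_le {α x : ℝ} (hx : 1 ≤ x) (M : ℕ) :
    (∑ j ∈ Icc ⌈α * M⌉₊ M, (M.choose j : ℝ) ^ 2 * x ^ (M - j)) * (x ^ α) ^ M
      ≤ 4 ^ M * x ^ M := by
  calc (∑ j ∈ Icc ⌈α * M⌉₊ M, (M.choose j : ℝ) ^ 2 * x ^ (M - j)) * (x ^ α) ^ M
      ≤ ∑ j ∈ Icc ⌈α * M⌉₊ M, (M.choose j : ℝ) ^ 2 * x ^ M := by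
        rw [sum_mul]
        refine sum_le_sum fun j hj => ?_
        rw [mem_Icc] at hj
        rw [mul_assoc]
        gcongr
        exact pow_sub_mul_rpow_pow_le hx hj.1 hj.2
    _ = (∑ j ∈ Icc ⌈α * M⌉₊ M, (M.choose j : ℝ) ^ 2) * x ^ M := (sum_mul ..).symm
    _ ≤ 4 ^ M * x ^ M := by
        gcongr
        exact_mod_cast sum_Icc_choose_sq_le_four_pow ⌈α * M⌉₊ M

/-- The counting contradiction in the entropy-compression argument: for `0 < α < 1`,
`k > 16^(1/α)` and `n ≥ 1`, there is an `M ≥ 1` with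
`k^M > ((k^(n+1) − 1)/(k − 1)) · C_M · Σ_{j=⌈αM⌉}^{M} (M choose j)² · k^(M−j)`. -/
theorem exists_M_counting_inequality_fails
    (α : ℝ) (hα0 : 0 < α) (hα1 : α < 1)
    (k : ℕ) (hk : (16 : ℝ) ^ (1 / α) < (k : ℝ))
    (n : ℕ) (hn : 0 < n) :
    ∃ M : ℕ, 0 < M ∧
      (((k : ℝ) ^ (n + 1) - 1) / ((k : ℝ) - 1)) * (catalan M : ℝ) *
          ∑ j ∈ Finset.Icc ⌈α * M⌉₊ M, ((M.choose j : ℝ)) ^ 2 * (k : ℝ) ^ (M - j)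
        < (k : ℝ) ^ M := by
  have hk1 : (1 : ℝ) < k :=
    (Real.one_lt_rpow (by norm_num) (by positivity)).trans hk
  have hkα : (16 : ℝ) < (k : ℝ) ^ α := by
    rw [one_div] at hk
    exact (Real.rpow_inv_lt_iff_of_pos (by norm_num) (by positivity) hα0).mp hk
  set K : ℝ := ((k : ℝ) ^ (n + 1) - 1) / ((k : ℝ) - 1)
  have hK : 0 ≤ K :=
    div_nonneg (sub_nonneg.mpr (one_le_pow₀ hk1.le)) (sub_nonneg.mpr hk1.le)
  have hratio : 1 < (k : ℝ) ^ α / 16 := by rwa [one_lt_div (by norm_num)]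
  obtain ⟨m, hm⟩ := pow_unbounded_of_one_lt K hratio
  refine ⟨m + 1, m.succ_pos, ?_⟩
  have hM : K < ((k : ℝ) ^ α / 16) ^ (m + 1) :=
    hm.trans_le (pow_le_pow_right₀ hratio.le m.le_succ)
  generalize m + 1 = M at hM ⊢
  rw [div_pow, lt_div_iff₀ (by positivity)] at hM
  have hcat : (catalan M : ℝ) ≤ 4 ^ M := by exact_mod_cast catalan_le_four_pow M
  have hsum := sum_choose_sq_mul_pow_mul_rpow_pow_le (α := α) hk1.le M
  set S := ∑ j ∈ Icc ⌈α * M⌉₊ M, (M.choose j : ℝ) ^ 2 * (k : ℝ) ^ (M - j)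
  refine lt_of_mul_lt_mul_right ?_ (by positivity : 0 ≤ ((k : ℝ) ^ α) ^ M)
  calc K * catalan M * S * ((k : ℝ) ^ α) ^ M
      = K * catalan M * (S * ((k : ℝ) ^ α) ^ M) := by ring
    _ ≤ K * 4 ^ M * (4 ^ M * (k : ℝ) ^ M) := by gcongr
    _ = K * 16 ^ M * (k : ℝ) ^ M := by
        rw [show (16 : ℝ) = 4 * 4 by norm_num, mul_pow]
        ring
    _ < ((k : ℝ) ^ α) ^ M * (k : ℝ) ^ M := by gcongr
    _ = (k : ℝ) ^ M * ((k : ℝ) ^ α) ^ M := mul_comm _ _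
end

section
/- There is no infinite word over a 3-letter alphabet with similarity coefficient at most 0.888. Equivalently, for every infinite word z : ℕ → Fin 3 there exist t ≥ 0, ℓ ≥ 1, and a list w that is a common subsequence of the adjacent factors z(t)⋯z(t+ℓ−1) and z(t+ℓ)⋯z(t+2ℓ−1) with length of w strictly greater than 0.888·ℓ. -/
/-- `u (m - 1), …, u 1, u 0`: the length-`m` prefix of `u`, reversed. -/
def revPrefix (u : ℕ → ℕ) : ℕ → List ℕ
  | 0 => []
  | m + 1 => u m :: revPrefix u m

/-- Decides (soundly) whether `x` and `y` have a common subsequence obtained by deleting at most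
`a` letters of `x` and at most `b` letters of `y`. The first argument is fuel. -/
def almostEqual : ℕ → ℕ → ℕ → List ℕ → List ℕ → Bool
  | 0, _, _, _, _ => false
  | _ + 1, _, _, [], _ => true
  | _ + 1, a, _, _ :: xs, [] => Nat.ble (xs.length + 1) a
  | k + 1, a, b, x :: xs, y :: ys =>
    bif Nat.beq x y then almostEqual k a b xs ys
    else (Nat.ble 1 a && almostEqual k (a - 1) b xs (y :: ys)) ||
      (Nat.ble 1 b && almostEqual k a (b - 1) (x :: xs) ys)

/-- Pairs `(ℓ, d)` of a block length and a number of deletions with `ℓ - d > 0.888 * ℓ`. -/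
def blockBudgets : List (ℕ × ℕ) :=
  [(1, 0), (2, 0), (3, 0), (4, 0), (6, 0), (8, 0), (18, 2), (11, 1), (12, 1), (9, 1), (10, 1),
    (13, 1), (19, 2), (15, 1), (17, 1), (14, 1)]

/-- Whether the reversed word `w` of length `m` starts with two similar adjacent blocks. -/
def startsSimilar (m : ℕ) (w : List ℕ) : List (ℕ × ℕ) → Bool
  | [] => false
  | (l, d) :: bs =>
    (Nat.ble (2 * l) m && almostEqual (2 * l + 1) d d ((w.drop l).take l) (w.take l)) ||
      startsSimilar m w bs

/-- Whether the first word is a prefix of the second one. -/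
def startsWith : List ℕ → List ℕ → Bool
  | [], _ => true
  | _ :: _, [] => false
  | x :: xs, y :: ys => Nat.beq x y && startsWith xs ys

/-- Whether the word `w` starts with one of the given words. -/
def startsWithAny (w : List ℕ) : List (List ℕ) → Bool
  | [] => false
  | q :: qs => startsWith q w || startsWithAny w qs

/-- Whether backtracking from the reversed word `w` of length `m` over the alphabet `{0, 1, 2}`
meets similar adjacent blocks or one of the reversed words `F` on every branch, within the depth
given by the second argument. -/
def backtrack (F : List (List ℕ)) : ℕ → ℕ → List ℕ → Bool
  | 0, _, _ => false
  | k + 1, m, w =>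
    startsWithAny w F || (startsSimilar m w blockBudgets ||
      (backtrack F k (m + 1) (0 :: w) && (backtrack F k (m + 1) (1 :: w) &&
        backtrack F k (m + 1) (2 :: w))))

/-- The images of `01202101`, reversed, under the permutations of the alphabet. -/
def orbitLong : List (List ℕ) :=
  [[1, 0, 1, 2, 0, 2, 1, 0], [0, 1, 0, 2, 1, 2, 0, 1], [2, 0, 2, 1, 0, 1, 2, 0],
    [0, 2, 0, 1, 2, 1, 0, 2], [2, 1, 2, 0, 1, 0, 2, 1], [1, 2, 1, 0, 2, 0, 1, 2]]

/-- The images of `01020`, reversed, under the permutations of the alphabet. -/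
def orbitShort : List (List ℕ) :=
  [[0, 2, 0, 1, 0], [1, 2, 1, 0, 1], [0, 1, 0, 2, 0], [2, 1, 2, 0, 2], [1, 0, 1, 2, 1],
    [2, 0, 2, 1, 2]]

theorem backtrack_long : backtrack [] 60 8 [1, 0, 1, 2, 0, 2, 1, 0] = true := by
  decide +kernel

theorem backtrack_short : backtrack orbitLong 60 5 [0, 2, 0, 1, 0] = true := by
  decide +kernel

theorem backtrack_nil : backtrack (orbitShort ++ orbitLong) 60 0 [] = true := by
  decide +kernel

theorem almostEqual_sound {k a b : ℕ} {x y : List ℕ} (h : almostEqual k a b x y = true) :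
    ∃ w : List ℕ, w.Sublist x ∧ w.Sublist y ∧ x.length ≤ w.length + a := by
  induction k generalizing a b x y with
  | zero => simp [almostEqual] at h
  | succ k ih =>
    match x, y with
    | [], y => exact ⟨[], by simp⟩
    | x :: xs, [] => exact ⟨[], by simp, by simp, by simpa [almostEqual] using h⟩
    | x :: xs, y :: ys =>
      rw [almostEqual] at h
      cases hxy : Nat.beq x y with
      | true =>
        obtain rfl := Nat.eq_of_beq_eq_true hxy
        rw [hxy, cond_true] at h
        obtain ⟨w, h₁, h₂, h₃⟩ := ih h
        exact ⟨x :: w, h₁.cons_cons x, h₂.cons_cons x, by simp only [List.length_cons]; omega⟩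
      | false =>
        rw [hxy, cond_false, Bool.or_eq_true, Bool.and_eq_true, Bool.and_eq_true] at h
        rcases h with ⟨ha, h⟩ | ⟨-, h⟩
        · have := Nat.le_of_ble_eq_true ha
          obtain ⟨w, h₁, h₂, h₃⟩ := ih h
          exact ⟨w, h₁.cons x, h₂, by simp only [List.length_cons]; omega⟩
        · obtain ⟨w, h₁, h₂, h₃⟩ := ih h
          exact ⟨w, h₁, h₂.cons y, h₃⟩

theorem drop_revPrefix (u : ℕ → ℕ) (m l : ℕ) : (revPrefix u (m + l)).drop l = revPrefix u m := by
  induction l with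
  | zero => rfl
  | succ l ih => simpa [revPrefix, ← add_assoc] using ih

theorem take_revPrefix (u : ℕ → ℕ) (m l : ℕ) :
    (revPrefix u (m + l)).take l = ((List.range l).map fun i => u (m + i)).reverse := by
  induction l with
  | zero => rfl
  | succ l ih => simpa [revPrefix, ← add_assoc, List.range_succ] using ih

/-- A word over `{0, 1, 2}` without adjacent blocks that are similar according to
`blockBudgets`. -/
def Dissimilar (u : ℕ → ℕ) : Prop :=
  (∀ i, u i < 3) ∧ ∀ p ∈ blockBudgets, ∀ t, ∀ w : List ℕ,
    w.Sublist ((List.range p.1).map fun i => u (t + i)) →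
    w.Sublist ((List.range p.1).map fun i => u (t + p.1 + i)) → w.length + p.2 < p.1

/-- No dissimilar word has the reversal of `p` as a prefix. -/
def Excluded (p : List ℕ) : Prop :=
  ∀ u, Dissimilar u → revPrefix u p.length ≠ p

theorem Dissimilar.shift {u : ℕ → ℕ} (hu : Dissimilar u) (s : ℕ) :
    Dissimilar fun i => u (s + i) :=
  ⟨fun i => hu.1 (s + i), fun p hp t w hx hy => hu.2 p hp (s + t) w
    (by simpa only [add_assoc] using hx) (by simpa only [add_assoc] using hy)⟩

theorem Dissimilar.swap {u : ℕ → ℕ} (hu : Dissimilar u) {a b : ℕ} (ha : a < 3) (hb : b < 3) :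
    Dissimilar fun i => Equiv.swap a b (u i) := by
  refine ⟨fun i => ?_, fun p hp t w hx hy => ?_⟩
  · have := hu.1 i
    simp only [Equiv.swap_apply_def]
    split_ifs <;> assumption
  · simpa using hu.2 p hp t (w.map (Equiv.swap a b))
      (by simpa [Function.comp_def] using hx.map (Equiv.swap a b))
      (by simpa [Function.comp_def] using hy.map (Equiv.swap a b))

theorem map_revPrefix (f : ℕ → ℕ) (u : ℕ → ℕ) (m : ℕ) :
    (revPrefix u m).map f = revPrefix (fun i => f (u i)) m := by
  induction m with
  | zero => rfl
  | succ m ih => simp [revPrefix, ih]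

theorem length_revPrefix (u : ℕ → ℕ) (m : ℕ) : (revPrefix u m).length = m := by
  induction m with
  | zero => rfl
  | succ m ih => simp [revPrefix, ih]

theorem Excluded.swap {p : List ℕ} (hp : Excluded p) {a b : ℕ} (ha : a < 3) (hb : b < 3) :
    Excluded (p.map (Equiv.swap a b)) := by
  intro u hu h
  apply hp _ (hu.swap ha hb)
  rw [← map_revPrefix]
  simpa [Function.comp_def] using congrArg (List.map (Equiv.swap a b)) h

theorem startsSimilar_eq_false {u : ℕ → ℕ} (hu : Dissimilar u) (m : ℕ) {bs : List (ℕ × ℕ)}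
    (hbs : bs ⊆ blockBudgets) : startsSimilar m (revPrefix u m) bs = false := by
  induction bs with
  | nil => rfl
  | cons p bs ih =>
    obtain ⟨l, d⟩ := p
    rw [List.cons_subset] at hbs
    rw [startsSimilar, ih hbs.2, Bool.or_false, ← Bool.not_eq_true, Bool.and_eq_true]
    rintro ⟨hm, h⟩
    obtain ⟨t, rfl⟩ := Nat.exists_eq_add_of_le' (Nat.le_of_ble_eq_true hm)
    rw [two_mul, ← add_assoc, drop_revPrefix, take_revPrefix, take_revPrefix] at h
    obtain ⟨w, h₁, h₂, h₃⟩ := almostEqual_sound h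
    have := hu.2 _ hbs.1 t w.reverse (by simpa using h₁.reverse) (by simpa using h₂.reverse)
    simp only [List.length_reverse, List.length_map, List.length_range] at this h₃
    omega

theorem startsWith_sound {q w : List ℕ} (h : startsWith q w = true) : q <+: w := by
  induction q generalizing w with
  | nil => exact List.nil_prefix
  | cons x xs ih =>
    cases w with
    | nil => simp [startsWith] at h
    | cons y ys =>
      rw [startsWith, Bool.and_eq_true] at h
      exact List.cons_prefix_cons.2 ⟨Nat.eq_of_beq_eq_true h.1, ih h.2⟩

theorem revPrefix_add (u : ℕ → ℕ) (s n : ℕ) :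
    revPrefix u (s + n) = revPrefix (fun i => u (s + i)) n ++ revPrefix u s := by
  induction n with
  | zero => rfl
  | succ n ih => simp [revPrefix, ih]

theorem startsWithAny_eq_false {u : ℕ → ℕ} (hu : Dissimilar u) (m : ℕ) {F : List (List ℕ)}
    (hF : ∀ q ∈ F, Excluded q) : startsWithAny (revPrefix u m) F = false := by
  induction F with
  | nil => rfl
  | cons q F ih =>
    rw [List.forall_mem_cons] at hF
    rw [startsWithAny, ih hF.2, Bool.or_false, ← Bool.not_eq_true]
    intro h
    have hq := startsWith_sound h
    have hlen := hq.length_le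
    rw [length_revPrefix] at hlen
    obtain ⟨s, rfl⟩ := Nat.exists_eq_add_of_le' hlen
    rw [revPrefix_add] at hq
    refine hF.1 _ (hu.shift s) ?_
    exact ((List.prefix_of_prefix_length_le hq (List.prefix_append _ _)
      (length_revPrefix _ _).ge).eq_of_length (length_revPrefix _ _).symm).symm

theorem backtrack_eq_false {u : ℕ → ℕ} (hu : Dissimilar u) {F : List (List ℕ)}
    (hF : ∀ q ∈ F, Excluded q) (k m : ℕ) : backtrack F k m (revPrefix u m) = false := by
  induction k generalizing m with
  | zero => rfl
  | succ k ih =>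
    have hm := hu.1 m
    have := ih (m + 1)
    rw [revPrefix] at this
    rw [backtrack, startsWithAny_eq_false hu m hF,
      startsSimilar_eq_false hu m (List.Subset.refl _)]
    interval_cases u m <;> simp [this]

theorem Excluded.of_backtrack {F : List (List ℕ)} (hF : ∀ q ∈ F, Excluded q) {k : ℕ}
    {p : List ℕ} (h : backtrack F k p.length p = true) : Excluded p := by
  intro u hu hp
  have := backtrack_eq_false hu hF k p.length
  simp [hp, h] at this

theorem excluded_orbit {p : List ℕ} (hp : Excluded p) :
    ∀ q ∈ [p, p.map (Equiv.swap 0 1), p.map (Equiv.swap 1 2), p.map (Equiv.swap 0 2),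
      (p.map (Equiv.swap 0 1)).map (Equiv.swap 0 2),
      (p.map (Equiv.swap 0 1)).map (Equiv.swap 1 2)], Excluded q := by
  have h := hp.swap (a := 0) (b := 1) (by decide) (by decide)
  simp only [List.forall_mem_cons]
  exact ⟨hp, h, hp.swap (by decide) (by decide), hp.swap (by decide) (by decide),
    h.swap (by decide) (by decide), h.swap (by decide) (by decide), by simp⟩

theorem excluded_of_mem_orbitLong : ∀ q ∈ orbitLong, Excluded q := by
  have h : Excluded [1, 0, 1, 2, 0, 2, 1, 0] := .of_backtrack (by simp) backtrack_long
  intro q hq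
  refine excluded_orbit h q ((?_ : orbitLong ⊆ _) hq)
  decide

theorem excluded_of_mem_orbitShort : ∀ q ∈ orbitShort, Excluded q := by
  have h : Excluded [0, 2, 0, 1, 0] := .of_backtrack excluded_of_mem_orbitLong backtrack_short
  intro q hq
  refine excluded_orbit h q ((?_ : orbitShort ⊆ _) hq)
  decide

theorem not_dissimilar (u : ℕ → ℕ) : ¬ Dissimilar u := fun hu =>
  Excluded.of_backtrack (p := []) (List.forall_mem_append.2
    ⟨excluded_of_mem_orbitShort, excluded_of_mem_orbitLong⟩) backtrack_nil u hu rfl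

/-- A common subsequence of the images of two words under an injective coding of the letters
comes from a common subsequence of the words themselves. -/
theorem exists_common_sublist_of_map {α β : Type*} {f : α → β} (hf : Function.Injective f)
    {x y : List α} {w : List β} (hx : w.Sublist (x.map f)) (hy : w.Sublist (y.map f)) :
    ∃ v : List α, v.Sublist x ∧ v.Sublist y ∧ v.length = w.length := by
  obtain ⟨v, hv, rfl⟩ := List.sublist_map_iff.1 hx
  obtain ⟨v', hv', h⟩ := List.sublist_map_iff.1 hy
  obtain rfl := List.map_injective_iff.2 hf h
  exact ⟨v, hv, hv', by simp⟩

/-- There is no infinite word over a 3-letter alphabet with similarity coefficient at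
most 0.888: every infinite word over Fin 3 has adjacent equal-length factors of some
length ℓ ≥ 1 admitting a common subsequence of length greater than 0.888·ℓ. -/
theorem no_infinite_word_fin3_similarity_le
    (z : ℕ → Fin 3) :
    ∃ (t ℓ : ℕ), 1 ≤ ℓ ∧
      ∃ w : List (Fin 3),
        w.Sublist ((List.range ℓ).map fun i => z (t + i)) ∧
        w.Sublist ((List.range ℓ).map fun i => z (t + ℓ + i)) ∧
        (0.888 : ℝ) * ℓ < (w.length : ℝ) := by
  have hz := not_dissimilar fun i => (z i).val
  simp only [Dissimilar, Fin.is_lt, implies_true, true_and, not_forall, not_lt] at hz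
  obtain ⟨⟨l, d⟩, hp, t, w, hx, hy, hw⟩ := hz
  have hbudget : ∀ p ∈ blockBudgets, 1 ≤ p.1 ∧ 1000 * p.2 < 112 * p.1 := by decide
  obtain ⟨hl, hd⟩ := hbudget _ hp
  obtain ⟨v, hvx, hvy, hv⟩ := exists_common_sublist_of_map (Fin.val_injective (n := 3))
    (x := (List.range l).map fun i => z (t + i)) (y := (List.range l).map fun i => z (t + l + i))
    (by simpa [Function.comp_def] using hx) (by simpa [Function.comp_def] using hy)
  refine ⟨t, l, hl, v, hvx, hvy, ?_⟩
  have hlen : 888 * l < 1000 * v.length := by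
    simp only at hd hw
    omega
  have : (888 : ℝ) * l < 1000 * v.length := by exact_mod_cast hlen
  linarith
end

section
/- There is no infinite word over a 5-letter alphabet with similarity coefficient at most 0.590. Equivalently, for every infinite word z : ℕ → Fin 5 there exist t ≥ 0, ℓ ≥ 1, and a list w that is a common subsequence of the adjacent factors z(t)⋯z(t+ℓ−1) and z(t+ℓ)⋯z(t+2ℓ−1) with length of w strictly greater than 0.590·ℓ. -/
namespace SimilarWords

/-- The word `z` has no two adjacent factors of equal length `ℓ` with a common subsequence of length
greater than `0.59 * ℓ`. -/
def Avoids {α : Type*} (z : ℕ → α) : Prop :=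
  ∀ (t ℓ : ℕ) (w : List α), 1 ≤ ℓ → w.Sublist ((List.range ℓ).map fun i => z (t + i)) →
    w.Sublist ((List.range ℓ).map fun i => z (t + ℓ + i)) → 100 * w.length ≤ 59 * ℓ

theorem Avoids.comp_equiv {α β : Type*} {z : ℕ → α} (hz : Avoids z) (e : α ≃ β) :
    Avoids (e ∘ z) := by
  intro t ℓ w hℓ hx hy
  have hx' := hx.map e.symm
  have hy' := hy.map e.symm
  simp only [List.map_map, Function.comp_def, Equiv.symm_apply_apply] at hx' hy'
  simpa using hz t ℓ _ hℓ hx' hy'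

/-- The length `p` prefix of `x` and the length `j` prefix of `y` have a common subsequence of
length `a`. -/
def HasCommon {α : Type*} (x y : ℕ → α) (p j a : ℕ) : Prop :=
  ∃ w : List α, w.Sublist ((List.range p).map x) ∧ w.Sublist ((List.range j).map y) ∧ w.length = a

theorem map_range_sublist {α : Type*} (x : ℕ → α) {p q : ℕ} (h : p ≤ q) :
    ((List.range p).map x).Sublist ((List.range q).map x) :=
  (List.range_sublist.2 h).map x

namespace HasCommon

variable {α : Type*} {x y : ℕ → α} {p p₁ j j₁ a : ℕ}

theorem zero : HasCommon x y p j 0 := ⟨[], by simp, by simp, rfl⟩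

theorem mono (h : HasCommon x y p j a) (hp : p ≤ p₁) (hj : j ≤ j₁) : HasCommon x y p₁ j₁ a := by
  obtain ⟨w, hx, hy, hw⟩ := h
  exact ⟨w, hx.trans (map_range_sublist x hp), hy.trans (map_range_sublist y hj), hw⟩

theorem extend {q : ℕ} (h : HasCommon x y q j a) (hq : q < p) (hxy : x q = y j) :
    HasCommon x y p (j + 1) (a + 1) := by
  obtain ⟨w, hx, hy, hw⟩ := h
  refine mono (p := q + 1) ⟨w ++ [x q], ?_, ?_, by simp [hw]⟩ hq le_rfl
  · simpa [List.range_succ] using hx.append (List.Sublist.refl [x q])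
  · simpa [List.range_succ, hxy] using hy.append (List.Sublist.refl [x q])

end HasCommon

theorem map_range_reverse {α : Type*} (x : ℕ → α) (ℓ : ℕ) :
    ((List.range ℓ).map x).reverse = (List.range ℓ).map fun i => x (ℓ - 1 - i) := by
  apply List.ext_getElem <;> simp

/-- The two adjacent factors of length `ℓ` that end at position `n`, read from right to left. -/
theorem Avoids.hasCommon_le {α : Type*} {z : ℕ → α} (hz : Avoids z) {n ℓ j a : ℕ} (hℓ : 1 ≤ ℓ)
    (hn : 2 * ℓ ≤ n + 1) (hj : j ≤ ℓ)
    (h : HasCommon (fun i => z (n - ℓ - i)) (fun i => z (n - i)) ℓ j a) : 100 * a ≤ 59 * ℓ := by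
  obtain ⟨w, hx, hy, rfl⟩ := h.mono le_rfl hj
  have key := hz (n + 1 - 2 * ℓ) ℓ w.reverse hℓ
  rw [List.length_reverse] at key
  apply key
  · convert hx.reverse using 1
    rw [map_range_reverse]
    refine List.map_congr_left fun i hi => ?_
    have := List.mem_range.1 hi
    congr 1; omega
  · convert hy.reverse using 1
    rw [map_range_reverse]
    refine List.map_congr_left fun i hi => ?_
    have := List.mem_range.1 hi
    congr 1; omega

/-! ### One field of the bit-parallel recurrence -/

/-- The number of zero bits of `f` below position `p`. -/
def zeros (f p : ℕ) : ℕ := Nat.count (fun i => f.testBit i = false) p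

/-- One row of the bit-parallel longest common subsequence recurrence on `ℓ`-bit columns. The bits
of `f` from position `ℓ` on count the zeros below. -/
def fieldStep (g m f : ℕ) : ℕ := (f + (f &&& m)) ||| ((f ^^^ (f &&& m)) &&& g)

/-- The carry into position `p` in the sum `f + u`. -/
def Carry (f u p : ℕ) : Prop := 2 ^ p ≤ f % 2 ^ p + u % 2 ^ p

instance (f u p : ℕ) : Decidable (Carry f u p) := Nat.decLe _ _

theorem carry_zero (f u : ℕ) : ¬ Carry f u 0 := by simp [Carry, Nat.mod_one]

theorem carry_succ (f m p : ℕ) : Carry f (f &&& m) (p + 1) ↔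
    f.testBit p = true ∧ (m.testBit p = true ∨ Carry f (f &&& m) p) := by
  have hf := Nat.mod_lt f (Nat.two_pow_pos p)
  have hu := Nat.mod_lt (f &&& m) (Nat.two_pow_pos p)
  rw [Carry, Carry, Nat.mod_pow_succ, Nat.mod_pow_succ, ← Nat.toNat_testBit, ← Nat.toNat_testBit,
    Nat.testBit_and, pow_succ]
  cases f.testBit p <;> cases m.testBit p <;> simp <;> omega

theorem testBit_add_carry (f u p : ℕ) :
    (f + u).testBit p = (f.testBit p ^^ u.testBit p ^^ decide (Carry f u p)) := by
  have h := BitVec.getLsbD_add (w := p + 1) (i := p) (by omega) (BitVec.ofNat _ f)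
    (BitVec.ofNat _ u)
  rw [← BitVec.ofNat_add] at h
  simp only [BitVec.carry, BitVec.getLsbD_ofNat, BitVec.toNat_ofNat] at h
  simpa [Carry, Nat.mod_mod_of_dvd _ (pow_dvd_pow 2 p.le_succ)] using h

theorem testBit_fieldStep {ℓ p : ℕ} (m f : ℕ) (hp : p < ℓ) :
    (fieldStep (2 ^ ℓ - 1) m f).testBit p =
      if f.testBit p ∧ m.testBit p = false then true else decide (Carry f (f &&& m) p) := by
  simp only [fieldStep, Nat.testBit_or, Nat.testBit_and, Nat.testBit_xor, testBit_add_carry,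
    Nat.testBit_two_pow_sub_one, hp]
  cases f.testBit p <;> cases m.testBit p <;> simp

theorem zeros_fieldStep {ℓ p : ℕ} (m f : ℕ) (hp : p ≤ ℓ) :
    zeros (fieldStep (2 ^ ℓ - 1) m f) p = zeros f p + if Carry f (f &&& m) p then 1 else 0 := by
  induction p with
  | zero => simp [zeros, carry_zero]
  | succ p ih =>
    have ih := ih (by omega)
    simp only [zeros, Nat.count_succ] at ih ⊢
    simp only [ih, testBit_fieldStep m f (Nat.lt_of_succ_le hp), carry_succ]
    cases f.testBit p <;> cases m.testBit p <;> by_cases h : Carry f (f &&& m) p <;> simp [h]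

theorem exists_of_carry {f m p : ℕ} (h : Carry f (f &&& m) p) :
    ∃ q < p, m.testBit q = true ∧ zeros f q = zeros f p := by
  induction p with
  | zero => exact absurd h (carry_zero _ _)
  | succ p ih =>
    obtain ⟨hf, hm | hc⟩ := (carry_succ f m p).1 h
    · exact ⟨p, by omega, hm, by simp [zeros, Nat.count_succ, hf]⟩
    · obtain ⟨q, hq, hm, hz⟩ := ih hc
      exact ⟨q, by omega, hm, by simpa [zeros, Nat.count_succ, hf] using hz⟩

theorem fieldStep_div {ℓ m : ℕ} (f : ℕ) (hm : m < 2 ^ ℓ) :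
    fieldStep (2 ^ ℓ - 1) m f / 2 ^ ℓ = f / 2 ^ ℓ + if Carry f (f &&& m) ℓ then 1 else 0 := by
  have hu : (f &&& m) / 2 ^ ℓ = 0 := Nat.div_eq_of_lt (Nat.and_lt_two_pow _ hm)
  have hg : (2 ^ ℓ - 1) / 2 ^ ℓ = 0 := Nat.div_eq_of_lt (Nat.sub_lt (Nat.two_pow_pos _) one_pos)
  rw [fieldStep, Nat.or_div_two_pow, Nat.and_div_two_pow, hg, Nat.and_zero, Nat.or_zero,
    Nat.add_div (Nat.two_pow_pos _), hu, add_zero]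
  rfl

/-- The invariant of a field `f` comparing the first `ℓ` letters of `x` with the first `j` letters
of `y`: its zero bits count a common subsequence, and its high part is `c` plus their number. -/
structure FieldInv {α : Type*} (x y : ℕ → α) (ℓ j c f : ℕ) : Prop where
  hasCommon : ∀ p ≤ ℓ, HasCommon x y p j (zeros f p)
  div_eq : f / 2 ^ ℓ = c + zeros f ℓ

theorem FieldInv.step {α : Type*} {x y : ℕ → α} {ℓ j c f m : ℕ} (h : FieldInv x y ℓ j c f)
    (hm : m < 2 ^ ℓ) (hxy : ∀ i, m.testBit i = true → x i = y j) :
    FieldInv x y ℓ (j + 1) c (fieldStep (2 ^ ℓ - 1) m f) := by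
  refine ⟨fun p hp => ?_, ?_⟩
  · rw [zeros_fieldStep m f hp]
    split_ifs with hc
    · obtain ⟨q, hq, hmq, hz⟩ := exists_of_carry hc
      rw [← hz]
      exact (h.hasCommon q (by omega)).extend hq (hxy q hmq)
    · exact (h.hasCommon p hp).mono le_rfl (by omega)
  · rw [fieldStep_div f hm, zeros_fieldStep m f le_rfl, h.div_eq, add_assoc]

theorem fieldStep_zero (g f : ℕ) : fieldStep g 0 f = f := by
  refine Nat.eq_of_testBit_eq fun i => ?_
  simp only [fieldStep, Nat.and_zero, Nat.xor_zero, add_zero, Nat.testBit_or, Nat.testBit_and]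
  cases f.testBit i <;> simp

theorem FieldInv.lt {α : Type*} {x y : ℕ → α} {ℓ j c f : ℕ} (h : FieldInv x y ℓ j c f)
    (hℓ : ℓ ≤ 16) (hc : c < 32) : f < 2 ^ 22 := by
  have hz : zeros f ℓ ≤ ℓ := Nat.count_le _
  have hd := h.div_eq
  calc f < 2 ^ ℓ * 2 ^ 6 := by
        rw [mul_comm]
        exact (Nat.div_lt_iff_lt_mul (Nat.two_pow_pos _)).1 (by omega)
    _ ≤ 2 ^ 16 * 2 ^ 6 := by gcongr; norm_num
    _ = 2 ^ 22 := by norm_num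

/-! ### Packing many fields into one number

Definitions that take part in the search are written with the operations of `Nat` themselves and
with recursors, as the kernel evaluates them.
-/

/-- Field `k` of a number divided into fields of `33` bits. -/
def field (V k : ℕ) : ℕ := V / 2 ^ (33 * k) % 2 ^ 33

theorem testBit_field (V k i : ℕ) :
    (field V k).testBit i = (decide (i < 33) && V.testBit (33 * k + i)) := by
  rw [field, Nat.testBit_mod_two_pow, Nat.testBit_div_two_pow, add_comm i]

theorem field_and (V U k : ℕ) : field (V &&& U) k = field V k &&& field U k := by
  refine Nat.eq_of_testBit_eq fun i => ?_
  simp only [testBit_field, Nat.testBit_and]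
  cases decide (i < 33) <;> simp

theorem field_or (V U k : ℕ) : field (V ||| U) k = field V k ||| field U k := by
  refine Nat.eq_of_testBit_eq fun i => ?_
  simp only [testBit_field, Nat.testBit_or]
  cases decide (i < 33) <;> simp

theorem field_xor (V U k : ℕ) : field (V ^^^ U) k = field V k ^^^ field U k := by
  refine Nat.eq_of_testBit_eq fun i => ?_
  simp only [testBit_field, Nat.testBit_xor]
  cases decide (i < 33) <;> simp

theorem mod_add_mod_lt {V U : ℕ} (h : ∀ k, field V k + field U k < 2 ^ 33) (k : ℕ) :
    V % 2 ^ (33 * k) + U % 2 ^ (33 * k) < 2 ^ (33 * k) := by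
  induction k with
  | zero => simp [Nat.mod_one]
  | succ k ih =>
    have hk := h k
    have hp (X : ℕ) :
        X % 2 ^ (33 * (k + 1)) = X % 2 ^ (33 * k) + 2 ^ (33 * k) * field X k := by
      rw [mul_add, mul_one, pow_add, Nat.mod_mul, field]
    rw [hp, hp, mul_add, mul_one, pow_add]
    nlinarith [Nat.mul_le_mul_left (2 ^ (33 * k)) (Nat.succ_le_of_lt hk)]

theorem field_add {V U : ℕ} (h : ∀ k, field V k + field U k < 2 ^ 33) (k : ℕ) :
    field (V + U) k = field V k + field U k := by
  have hk := h k
  have hm := mod_add_mod_lt h k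
  rw [field, Nat.add_div (Nat.two_pow_pos _), if_neg (by omega), add_zero, Nat.add_mod]
  exact Nat.mod_eq_of_lt hk

/-- The number whose first `n` fields are `f 0, …, f (n - 1)`. -/
def pack (f : ℕ → ℕ) : ℕ → ℕ
  | 0 => 0
  | n + 1 => Nat.add (pack f n) (Nat.mul (f n) (Nat.pow 2 (Nat.mul 33 n)))

theorem pack_succ (f : ℕ → ℕ) (n : ℕ) : pack f (n + 1) = 2 ^ (33 * n) * f n + pack f n := by
  rw [add_comm (_ * _), mul_comm]; rfl

theorem pack_lt {f : ℕ → ℕ} (hf : ∀ k, f k < 2 ^ 33) (n : ℕ) : pack f n < 2 ^ (33 * n) := by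
  induction n with
  | zero => simp [pack]
  | succ n ih =>
    rw [pack_succ, mul_add, mul_one, pow_add]
    nlinarith [Nat.mul_le_mul_left (2 ^ (33 * n)) (Nat.succ_le_of_lt (hf n))]

theorem field_pack {f : ℕ → ℕ} (hf : ∀ k, f k < 2 ^ 33) (n k : ℕ) :
    field (pack f n) k = if k < n then f k else 0 := by
  induction n with
  | zero => simp [pack, field]
  | succ n ih =>
    refine Nat.eq_of_testBit_eq fun i => ?_
    have ih := congrArg (fun x => x.testBit i) ih
    simp only [testBit_field] at ih ⊢
    by_cases hi : i < 33
    · rw [pack_succ, Nat.testBit_two_pow_mul_add _ (pack_lt hf n)]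
      rcases lt_trichotomy k n with h | rfl | h
      · simpa [hi, h, h.le, show 33 * k + i < 33 * n by omega] using ih
      · simp [hi]
      · have := Nat.testBit_lt_two_pow ((hf n).trans_le (Nat.pow_le_pow_right two_pos
          (show 33 ≤ 33 * k + i - 33 * n by omega)))
        simp [this, show ¬ 33 * k + i < 33 * n by omega, show ¬ k < n + 1 by omega]
    · have := Nat.testBit_lt_two_pow ((hf k).trans_le (Nat.pow_le_pow_right two_pos (not_lt.1 hi)))
      split_ifs <;> simp [hi, this]

/-- Field `k` serves the factor length `len k`. -/
def len (k : ℕ) : ℕ := k % 16 + 1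

theorem len_le (k : ℕ) : len k ≤ 16 := by unfold len; omega

theorem two_pow_len_le (k : ℕ) : 2 ^ len k ≤ 2 ^ 16 := Nat.pow_le_pow_right two_pos (len_le k)

/-- Multiplication by this number copies the bits of a number to the first `n` fields. -/
def spreadFactor : ℕ → ℕ
  | 0 => 0
  | n + 1 => Nat.add (spreadFactor n) (Nat.pow 2 (33 * n - n % 16))

theorem mul_spreadFactor_succ (O n : ℕ) :
    O * spreadFactor (n + 1) = 2 ^ (33 * n - n % 16) * O + O * spreadFactor n := by
  rw [add_comm (_ * _), mul_comm _ O, ← mul_add]; rfl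

theorem mul_spreadFactor_lt {O : ℕ} (hO : O < 2 ^ 32) (n : ℕ) :
    O * spreadFactor n < 2 ^ (33 * n - n % 16) := by
  induction n with
  | zero => simp [spreadFactor]
  | succ n ih =>
    rw [mul_spreadFactor_succ]
    calc 2 ^ (33 * n - n % 16) * O + O * spreadFactor n
        < 2 ^ (33 * n - n % 16) * 2 ^ 32 := by
          nlinarith [Nat.mul_le_mul_left (2 ^ (33 * n - n % 16)) (Nat.succ_le_of_lt hO)]
      _ = 2 ^ (33 * n - n % 16 + 32) := (pow_add _ _ _).symm
      _ ≤ _ := Nat.pow_le_pow_right two_pos (by omega)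

theorem testBit_mul_spreadFactor {O : ℕ} (hO : O < 2 ^ 32) {n k i : ℕ} (hk : k < n) (hi : i < 32) :
    (O * spreadFactor n).testBit (33 * k - k % 16 + i) = O.testBit i := by
  induction n with
  | zero => omega
  | succ n ih =>
    rw [mul_spreadFactor_succ, Nat.testBit_two_pow_mul_add _ (mul_spreadFactor_lt hO n)]
    rcases Nat.lt_succ_iff_lt_or_eq.1 hk with h | rfl
    · rw [if_pos (by omega), ih h]
    · rw [if_neg (by omega), Nat.add_sub_cancel_left]

/-- The multiplier of `spread`. -/
def spreader : ℕ := spreadFactor 80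

/-- Copies the bits of `o` from position `len k - 1` on to field `k`. -/
def spread (o : ℕ) : ℕ := Nat.mul (Nat.mod o 4294967296) spreader

theorem testBit_spread (o : ℕ) {k i : ℕ} (hk : k < 80) (hi : i < 16) :
    (spread o).testBit (33 * k + i) = o.testBit (k % 16 + i) := by
  have h := testBit_mul_spreadFactor (Nat.mod_lt o (Nat.two_pow_pos 32)) hk
    (show k % 16 + i < 32 by omega)
  rw [Nat.testBit_mod_two_pow, decide_eq_true (by omega), Bool.true_and] at h
  rw [← h]
  congr 1
  omega

/-! ### The packed recurrence -/

/-- The columns of all fields. -/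
def fieldMask : ℕ := pack (fun k => 2 ^ len k - 1) 80

/-- The columns of the fields whose factor length exceeds `j`. -/
def stepMask (j : ℕ) : ℕ := pack (fun k => if j < len k then 2 ^ len k - 1 else 0) 80

/-- The columns of the fields that assume the letter of index `c` to come next. -/
def blockMask (c : ℕ) : ℕ := pack (fun k => if k / 16 = c then 2 ^ len k - 1 else 0) 80

/-- The least length of a common subsequence that is forbidden for factors of length `l`. -/
def need (l : ℕ) : ℕ := 59 * l / 100 + 1

/-- The state in which no letters of the second factors are read. Field `k` is offset such that bit
`len k + 5` signals a common subsequence of length `need (len k)`. -/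
def initial : ℕ := pack (fun k => 2 ^ len k - 1 + (32 - need (len k)) * 2 ^ len k) 80

/-- The signal bits of the fields that assume the letter of index `c` to come next. -/
def testMask (c : ℕ) : ℕ := pack (fun k => if k / 16 = c then 2 ^ (len k + 5) else 0) 80

theorem field_fieldMask (k : ℕ) : field fieldMask k = if k < 80 then 2 ^ len k - 1 else 0 :=
  field_pack (fun k => by have := two_pow_len_le k; omega) 80 k

theorem field_stepMask (j k : ℕ) :
    field (stepMask j) k = if k < 80 then if j < len k then 2 ^ len k - 1 else 0 else 0 :=
  field_pack (fun k => by have := two_pow_len_le k; split_ifs <;> omega) 80 k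

theorem field_blockMask (c k : ℕ) :
    field (blockMask c) k = if k < 80 then if k / 16 = c then 2 ^ len k - 1 else 0 else 0 :=
  field_pack (fun k => by have := two_pow_len_le k; split_ifs <;> omega) 80 k

theorem field_initial (k : ℕ) : field initial k =
    if k < 80 then 2 ^ len k - 1 + (32 - need (len k)) * 2 ^ len k else 0 :=
  field_pack (fun k => by
    have := two_pow_len_le k
    have : 32 - need (len k) ≤ 31 := by unfold need; omega
    nlinarith [Nat.sub_le (2 ^ len k) 1]) 80 k

theorem field_testMask (c k : ℕ) :
    field (testMask c) k = if k < 80 then if k / 16 = c then 2 ^ (len k + 5) else 0 else 0 :=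
  field_pack (fun k => by have := two_pow_len_le k; rw [pow_add]; split_ifs <;> omega) 80 k

/-- `fieldStep` on all fields at once. -/
def step (m v : ℕ) : ℕ :=
  Nat.lor (Nat.add v (Nat.land v m)) (Nat.land (Nat.xor v (Nat.land v m)) fieldMask)

theorem step_eq (m v : ℕ) : step m v = fieldStep fieldMask m v := rfl

theorem field_step {m v : ℕ} (h : ∀ k, field v k < 2 ^ 22) (k : ℕ) :
    field (step m v) k = fieldStep (field fieldMask k) (field m k) (field v k) := by
  rw [step_eq, fieldStep, field_or, field_and, field_xor, field_and, field_add, field_and,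
    fieldStep]
  intro k
  have h1 : field v k &&& field m k ≤ field v k := Nat.and_le_left
  have := h k
  rw [field_and]
  omega

theorem zeros_eq_zero {f p : ℕ} (h : ∀ i < p, f.testBit i = true) : zeros f p = 0 := by
  simpa [zeros, Nat.count_iff_forall_not] using h

/-! ### Letters and the columns of the recurrence -/

/-- The alphabet. -/
inductive Letter | a | b | c | d | e
  deriving DecidableEq

namespace Letter

instance : Fintype Letter := ⟨{a, b, c, d, e}, fun x => by cases x <;> decide⟩

/-- Select one of five numbers by a letter. -/
@[reducible] noncomputable def sel (x : Letter) (p q r s t : ℕ) : ℕ := Letter.rec p q r s t x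

/-- The position of a letter in the alphabet. -/
def idx : Letter → ℕ
  | a => 0 | b => 1 | c => 2 | d => 3 | e => 4

/-- The letter at a position of the alphabet. -/
def ofIdx : ℕ → Letter
  | 0 => a | 1 => b | 2 => c | 3 => d | _ => e

theorem ofIdx_idx (x : Letter) : ofIdx x.idx = x := by cases x <;> rfl

end Letter

/-- The letters of `z` from position `n` downwards, with the letter at `n` replaced by `x`. -/
def latest (z : ℕ → Letter) (n : ℕ) (x : Letter) (j : ℕ) : Letter := if j = 0 then x else z (n - j)

theorem latest_self (z : ℕ → Letter) (n : ℕ) : latest z n (z n) = fun j => z (n - j) := by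
  funext j
  rw [latest]
  split_ifs with h <;> simp [h]

/-- Field `k` of `V` compares the two factors of length `len k` of the word that ends at position
`n` with the letter of index `k / 16`, using the last `j` letters of the second factor. -/
structure PackedInv (z : ℕ → Letter) (n j V : ℕ) : Prop where
  fieldInv : ∀ k < 80, FieldInv (fun i => z (n - len k - i)) (latest z n (.ofIdx (k / 16))) (len k)
    (min j (len k)) (32 - need (len k)) (field V k)
  eq_zero : ∀ k, 80 ≤ k → field V k = 0

/-- The bits of `M` mark matches with letter `j` of the second factors. -/
def MaskSound (z : ℕ → Letter) (n j M : ℕ) : Prop :=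
  ∀ k i, (field M k).testBit i = true →
    k < 80 ∧ i < len k ∧ j < len k ∧ z (n - len k - i) = latest z n (.ofIdx (k / 16)) j

theorem packedInv_initial (z : ℕ → Letter) (n : ℕ) : PackedInv z n 0 initial := by
  refine ⟨fun k hk => ?_, fun k hk => by rw [field_initial, if_neg (by omega)]⟩
  rw [field_initial, if_pos hk, add_comm, mul_comm]
  have hlt : 2 ^ len k - 1 < 2 ^ len k := Nat.sub_lt (Nat.two_pow_pos _) one_pos
  have hz : ∀ p ≤ len k, zeros (2 ^ len k * (32 - need (len k)) + (2 ^ len k - 1)) p = 0 :=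
    fun p hp => zeros_eq_zero fun i hi => by
      rw [Nat.testBit_two_pow_mul_add _ hlt, if_pos (by omega), Nat.testBit_two_pow_sub_one,
        decide_eq_true (by omega)]
  refine ⟨fun p hp => by rw [hz p hp]; exact .zero, ?_⟩
  rw [hz _ le_rfl, Nat.mul_add_div (Nat.two_pow_pos _), Nat.div_eq_of_lt hlt]

namespace PackedInv

variable {z : ℕ → Letter} {n j V M : ℕ}

theorem field_lt (h : PackedInv z n j V) (k : ℕ) : field V k < 2 ^ 22 := by
  by_cases hk : k < 80
  · exact (h.fieldInv k hk).lt (len_le k) (by unfold need; omega)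
  · rw [h.eq_zero k (by omega)]; norm_num

theorem step (h : PackedInv z n j V) (hM : MaskSound z n j M) :
    PackedInv z n (j + 1) (step M V) := by
  refine ⟨fun k hk => ?_, fun k hk => ?_⟩ <;> rw [field_step h.field_lt, field_fieldMask]
  · rw [if_pos hk]
    by_cases hj : j < len k
    · rw [min_eq_left (by omega)]
      have hf := h.fieldInv k hk
      rw [min_eq_left hj.le] at hf
      refine hf.step (Nat.lt_pow_two_of_testBit _ fun i hi => ?_) fun i hi => (hM k i hi).2.2.2
      by_contra hc
      exact absurd (hM k i (by simpa using hc)).2.1 (by omega)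
    · have h0 : field M k = 0 := Nat.zero_of_testBit_eq_false fun i => by
        by_contra hc
        exact hj (hM k i (by simpa using hc)).2.2.1
      rw [h0, fieldStep_zero, min_eq_right (by omega)]
      simpa [min_eq_right (not_lt.1 hj)] using h.fieldInv k hk
  · have h0 : field M k = 0 := Nat.zero_of_testBit_eq_false fun i => by
      by_contra hc
      exact absurd (hM k i (by simpa using hc)).1 (by omega)
    rw [h0, fieldStep_zero, h.eq_zero k hk]

theorem and_testMask_eq_zero (h : PackedInv z n j V) (hz : Avoids z) (hn : 32 ≤ n) :
    V &&& testMask (z n).idx = 0 := by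
  by_contra hne
  obtain ⟨b, hb⟩ := Nat.exists_testBit_of_ne_zero hne
  rw [Nat.testBit_and, Bool.and_eq_true, ← Nat.div_add_mod b 33] at hb
  have hlt : b % 33 < 33 := Nat.mod_lt _ (by norm_num)
  have hV := testBit_field V (b / 33) (b % 33)
  have hT := testBit_field (testMask (z n).idx) (b / 33) (b % 33)
  rw [hb.1, decide_eq_true hlt] at hV
  rw [hb.2, decide_eq_true hlt, field_testMask] at hT
  generalize b / 33 = k at hV hT
  generalize b % 33 = i at hV hT
  split_ifs at hT with hk hc
  · have hi : len k + 5 = i := by simpa [Nat.testBit_two_pow] using hT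
    have hf := h.fieldInv k hk
    have hge := Nat.ge_two_pow_of_testBit hV
    rw [← hi, pow_add, mul_comm, ge_iff_le, ← Nat.le_div_iff_mul_le (Nat.two_pow_pos _),
      hf.div_eq] at hge
    rw [hc, Letter.ofIdx_idx, latest_self] at hf
    have hl := len_le k
    have := hz.hasCommon_le (by unfold len; omega) (by omega) (min_le_right _ _)
      (hf.hasCommon _ le_rfl)
    unfold need at hge
    omega
  · simp at hT
  · simp at hT

end PackedInv

/-! ### Masks of a word -/

/-- The list `ys` is a suffix of the letters of `z` before position `n`, read backwards. -/
def Reads (z : ℕ → Letter) (n : ℕ) (ys : List Letter) : Prop :=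
  ∀ j y, ys[j]? = some y → z (n - 1 - j) = y

theorem Reads.tail {z : ℕ → Letter} {n : ℕ} {y : Letter} {ys : List Letter}
    (h : Reads z n (y :: ys)) : Reads z (n - 1) ys := fun j x hx => by
  rw [← h (j + 1) x (by simpa using hx)]
  congr 1; omega

theorem Reads.cons {z : ℕ → Letter} {n : ℕ} {ys : List Letter} (h : Reads z n ys) :
    Reads z (n + 1) (z n :: ys) := by
  rintro (_ | j) y hy
  · simpa using hy
  · rw [← h j y (by simpa using hy)]
    congr 1; omega

/-- The positions of a letter in a list, as a bit mask. -/
def maskOf (x : Letter) : List Letter → ℕ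
  | [] => 0
  | y :: ys => if x = y then Nat.succ (Nat.mul 2 (maskOf x ys)) else Nat.mul 2 (maskOf x ys)

theorem testBit_maskOf {x : Letter} {ys : List Letter} {i : ℕ}
    (h : (maskOf x ys).testBit i = true) : ys[i]? = some x := by
  induction ys generalizing i with
  | nil => simp [maskOf] at h
  | cons y ys ih =>
    have hm : maskOf x (y :: ys) = 2 * maskOf x ys + if x = y then 1 else 0 := by
      rw [maskOf]; split_ifs <;> rfl
    rw [hm] at h
    cases i with
    | zero => split_ifs at h with hxy <;> simp_all
    | succ i =>
      rw [Nat.testBit_succ] at h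
      rw [List.getElem?_cons_succ]
      apply ih
      convert h using 2
      split_ifs <;> omega

theorem testBit_spread_maskOf {z : ℕ → Letter} {n k i : ℕ} {ys : List Letter} (hys : Reads z n ys)
    (x : Letter) (hk : k < 80) (hi : i < len k)
    (h : (spread (maskOf x ys)).testBit (33 * k + i) = true) : z (n - len k - i) = x := by
  rw [testBit_spread _ hk (by have := len_le k; omega)] at h
  rw [← hys _ _ (testBit_maskOf h)]
  congr 1; unfold len; omega

theorem testBit_field_and {V U k i : ℕ} (h : (field (V &&& U) k).testBit i = true) :
    V.testBit (33 * k + i) = true ∧ (field U k).testBit i = true := by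
  rw [field_and, Nat.testBit_and, Bool.and_eq_true, testBit_field V, Bool.and_eq_true] at h
  exact ⟨h.1.2, h.2⟩

theorem maskSound_stepMask {z : ℕ → Letter} {n j : ℕ} {ys : List Letter} (hys : Reads z n ys)
    (hj : j ≠ 0) :
    MaskSound z n j (spread (maskOf (z (n - j)) ys) &&& stepMask j) := by
  intro k i h
  obtain ⟨hs, hm⟩ := testBit_field_and h
  rw [field_stepMask] at hm
  split_ifs at hm with hk hl
  · have hi : i < len k := by simpa using hm
    exact ⟨hk, hi, hl, by rw [testBit_spread_maskOf hys _ hk hi hs, latest, if_neg hj]⟩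
  · simp at hm
  · simp at hm

theorem maskSound_blockMask {z : ℕ → Letter} {n : ℕ} {ys : List Letter} (hys : Reads z n ys)
    (x : Letter) : MaskSound z n 0 (spread (maskOf x ys) &&& blockMask x.idx) := by
  intro k i h
  obtain ⟨hs, hm⟩ := testBit_field_and h
  rw [field_blockMask] at hm
  split_ifs at hm with hk hl
  · have hi : i < len k := by simpa using hm
    refine ⟨hk, hi, Nat.succ_pos _, ?_⟩
    rw [testBit_spread_maskOf hys _ hk hi hs, latest, if_pos rfl, hl, Letter.ofIdx_idx]
  · simp at hm
  · simp at hm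

theorem MaskSound.or {z : ℕ → Letter} {n j M N : ℕ} (hM : MaskSound z n j M)
    (hN : MaskSound z n j N) : MaskSound z n j (M ||| N) := by
  intro k i h
  rw [field_or, Nat.testBit_or, Bool.or_eq_true] at h
  exact h.elim (hM k i) (hN k i)

/-- Run the recurrence along the second factors; `p` gives the matches of a letter. -/
noncomputable def run (p : Letter → ℕ) (hs : List ℕ) : List Letter → ℕ → ℕ :=
  List.rec (motive := fun _ => List Letter → ℕ → ℕ) (fun _ v => v)
    (fun h _ ih ys v => List.rec (motive := fun _ => ℕ) v
      (fun y ys _ => ih ys (step (Nat.land (p y) h) v)) ys) hs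

theorem exists_packedInv_run {z : ℕ → Letter} {n : ℕ} {ys : List Letter} (hys : Reads z n ys)
    {hs : List ℕ} {l : List Letter} {j V : ℕ} (hj : j ≠ 0)
    (hhs : ∀ i h, hs[i]? = some h → h = stepMask (j + i)) (hl : Reads z (n + 1 - j) l)
    (hV : PackedInv z n j V) :
    ∃ j₁, PackedInv z n j₁ (run (fun y => spread (maskOf y ys)) hs l V) := by
  induction hs generalizing l j V with
  | nil => exact ⟨j, hV⟩
  | cons h hs ih =>
    cases l with
    | nil => exact ⟨j, hV⟩
    | cons y l =>
      have hy : z (n - j) = y := by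
        rw [← hl 0 y rfl]
        congr 1; omega
      have hh : h = stepMask j := hhs 0 h (List.getElem?_cons_zero)
      refine ih (j := j + 1) (by omega) (fun i h hi => ?_) ?_
        (hV.step ?_)
      · rw [hhs (i + 1) h (by simpa using hi)]
        congr 1; omega
      · convert hl.tail using 1; omega
      · rw [← hy, hh]
        exact maskSound_stepMask hys hj

/-- The values of `stepMask` in the order of use. -/
def stepMasks : List ℕ := [stepMask 1, stepMask 2, stepMask 3, stepMask 4, stepMask 5, stepMask 6,
  stepMask 7, stepMask 8, stepMask 9, stepMask 10, stepMask 11, stepMask 12, stepMask 13,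
  stepMask 14, stepMask 15]

theorem stepMasks_eq : stepMasks = (List.range' 1 15).map stepMask := rfl

/-- The values of `stepMask` used when `n` rounds of the search are left: about half as many as
letters are known. -/
def masksFor (n : ℕ) : List ℕ := stepMasks.take ((64 - n) / 2)

theorem eq_of_masksFor {m i h : ℕ} (hi : (masksFor m)[i]? = some h) : h = stepMask (1 + i) := by
  rw [masksFor, stepMasks_eq, List.getElem?_take] at hi
  split_ifs at hi
  simp only [List.getElem?_map, Option.map_eq_some_iff] at hi
  obtain ⟨a, ha, rfl⟩ := hi
  rw [List.getElem?_eq_some_iff] at ha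
  obtain ⟨_, rfl⟩ := ha
  simp

def blockMaskA : ℕ := blockMask 0
def blockMaskB : ℕ := blockMask 1
def blockMaskC : ℕ := blockMask 2
def blockMaskD : ℕ := blockMask 3
def blockMaskE : ℕ := blockMask 4

/-- Compare, for all possible next letters, all pairs of adjacent factors at the end of the word. -/
noncomputable def sims (hs : List ℕ) (ys : List Letter) (p q r s t : ℕ) : ℕ :=
  run (fun y => y.sel p q r s t) hs ys
    (step (Nat.lor (Nat.land p blockMaskA) (Nat.lor (Nat.land q blockMaskB)
      (Nat.lor (Nat.land r blockMaskC) (Nat.lor (Nat.land s blockMaskD)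
        (Nat.land t blockMaskE))))) initial)

theorem sims_and_testMask_eq_zero {z : ℕ → Letter} (hz : Avoids z) {n : ℕ} (hn : 32 ≤ n)
    {ys : List Letter} (hys : Reads z n ys) (m : ℕ) :
    sims (masksFor m) ys (spread (maskOf .a ys)) (spread (maskOf .b ys)) (spread (maskOf .c ys))
      (spread (maskOf .d ys)) (spread (maskOf .e ys)) &&& testMask (z n).idx = 0 := by
  have hp : (fun y : Letter => y.sel (spread (maskOf .a ys)) (spread (maskOf .b ys))
      (spread (maskOf .c ys)) (spread (maskOf .d ys)) (spread (maskOf .e ys))) =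
      fun y => spread (maskOf y ys) := by
    funext y; cases y <;> rfl
  have hfirst := (packedInv_initial z n).step <| (maskSound_blockMask hys .a).or <|
    (maskSound_blockMask hys .b).or <| (maskSound_blockMask hys .c).or <|
    (maskSound_blockMask hys .d).or <| maskSound_blockMask hys .e
  obtain ⟨j, hj⟩ := exists_packedInv_run hys one_ne_zero (fun _ _ => eq_of_masksFor (m := m)) hys
    hfirst
  rw [sims, hp]
  exact hj.and_testMask_eq_zero hz hn

/-! ### The search -/

def testMaskA : ℕ := testMask 0
def testMaskB : ℕ := testMask 1
def testMaskC : ℕ := testMask 2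
def testMaskD : ℕ := testMask 3
def testMaskE : ℕ := testMask 4

/-- `1` if the mask `o` has none of its first `D` bits set, and `0` otherwise. -/
def absent (D o : ℕ) : ℕ := Nat.sub 1 (Nat.land o (Nat.sub (Nat.pow 2 D) 1))

/-- Whether at least `D` letters have one of the first `D` bits of their mask set. -/
def blocked (D p q r s t : ℕ) : Bool :=
  Nat.ble (Nat.add D (Nat.add (absent D p) (Nat.add (absent D q) (Nat.add (absent D r)
    (Nat.add (absent D s) (absent D t)))))) 5

/-- Whether every sequence of `fuel` letters appended to the word `ys`, given with the masks of its
letters, creates a forbidden pair of factors or `D` consecutive distinct letters. -/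
noncomputable def search (D fuel : ℕ) : List Letter → ℕ → ℕ → ℕ → ℕ → ℕ → Bool :=
  Nat.rec (motive := fun _ => List Letter → ℕ → ℕ → ℕ → ℕ → ℕ → Bool)
    (fun _ _ _ _ _ _ => false)
    (fun n ih ys p q r s t =>
      (fun v p₀ q₀ r₀ s₀ t₀ =>
        (fun (child : ℕ → Letter → ℕ → ℕ → ℕ → ℕ → ℕ → Bool) =>
          and (child testMaskA .a (Nat.succ p₀) q₀ r₀ s₀ t₀)
          (and (child testMaskB .b p₀ (Nat.succ q₀) r₀ s₀ t₀)
          (and (child testMaskC .c p₀ q₀ (Nat.succ r₀) s₀ t₀)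
          (and (child testMaskD .d p₀ q₀ r₀ (Nat.succ s₀) t₀)
          (child testMaskE .e p₀ q₀ r₀ s₀ (Nat.succ t₀))))))
        (fun test x p q r s t =>
          Bool.rec true (Bool.rec (ih (x :: ys) p q r s t) true (blocked D p q r s t))
            (Nat.beq (Nat.land v test) 0)))
      (sims (masksFor n) ys (spread p) (spread q) (spread r) (spread s) (spread t))
      (Nat.mul 2 p) (Nat.mul 2 q) (Nat.mul 2 r) (Nat.mul 2 s) (Nat.mul 2 t)) fuel

/-- `search` started from the masks of `ys`. -/
noncomputable def searchFrom (D fuel : ℕ) (ys : List Letter) : Bool :=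
  search D fuel ys (maskOf .a ys) (maskOf .b ys) (maskOf .c ys) (maskOf .d ys) (maskOf .e ys)

/-- `blocked` for the masks of `ys`. -/
def blockedFrom (D : ℕ) (ys : List Letter) : Bool :=
  blocked D (maskOf .a ys) (maskOf .b ys) (maskOf .c ys) (maskOf .d ys) (maskOf .e ys)

theorem search_child {D fuel : ℕ} {ys : List Letter} (h : searchFrom D (fuel + 1) ys = true)
    (x : Letter)
    (hx : sims (masksFor fuel) ys (spread (maskOf .a ys)) (spread (maskOf .b ys))
      (spread (maskOf .c ys)) (spread (maskOf .d ys)) (spread (maskOf .e ys)) &&&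
        testMask x.idx = 0) :
    blockedFrom D (x :: ys) = true ∨ searchFrom D fuel (x :: ys) = true := by
  have key : (Bool.rec true (Bool.rec (searchFrom D fuel (x :: ys)) true (blockedFrom D (x :: ys)))
      (Nat.beq (sims (masksFor fuel) ys (spread (maskOf .a ys)) (spread (maskOf .b ys))
      (spread (maskOf .c ys)) (spread (maskOf .d ys)) (spread (maskOf .e ys)) &&&
        testMask x.idx) 0) : Bool) = true := by
    obtain ⟨ha, h⟩ := Bool.and_eq_true_iff.1 h
    obtain ⟨hb, h⟩ := Bool.and_eq_true_iff.1 h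
    obtain ⟨hc, h⟩ := Bool.and_eq_true_iff.1 h
    obtain ⟨hd, he⟩ := Bool.and_eq_true_iff.1 h
    cases x
    exacts [ha, hb, hc, hd, he]
  rw [hx] at key
  cases hb : blockedFrom D (x :: ys)
  · rw [hb] at key
    exact Or.inr key
  · exact Or.inl rfl

/-- No `D` letters of `z` ending at a late position are distinct. -/
def NoDistinct {α : Type*} (z : ℕ → α) (D T : ℕ) : Prop :=
  ∀ n ≥ T, ¬ Set.InjOn (fun i => z (n - i)) (Set.Iio D)

theorem NoDistinct.comp_equiv {α β : Type*} {z : ℕ → α} {D T : ℕ} (h : NoDistinct z D T)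
    (e : α ≃ β) : NoDistinct (e ∘ z) D T :=
  fun n hn hi => h n hn fun _ hx _ hy hxy => hi hx hy (congrArg e hxy)

theorem sum_letter (f : Letter → ℕ) :
    ∑ x, f x = f .a + (f .b + (f .c + (f .d + f .e))) := by
  change ∑ x ∈ {.a, .b, .c, .d, .e}, f x = _
  simp [Finset.sum_insert]

theorem injOn_of_blockedFrom {z : ℕ → Letter} {n D : ℕ} {ys : List Letter}
    (hys : Reads z (n + 1) ys) (h : blockedFrom D ys = true) :
    Set.InjOn (fun i => z (n - i)) (Set.Iio D) := by
  have hle : D + ∑ x, absent D (maskOf x ys) ≤ 5 := by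
    rw [sum_letter]
    exact Nat.le_of_ble_eq_true h
  let S : Finset Letter := {x | maskOf x ys &&& (2 ^ D - 1) ≠ 0}
  have hS : S ⊆ (Finset.range D).image fun i => z (n - i) := by
    intro x hx
    obtain ⟨i, hi⟩ := Nat.exists_testBit_of_ne_zero (Finset.mem_filter.1 hx).2
    rw [Nat.testBit_and, Nat.testBit_two_pow_sub_one, Bool.and_eq_true, decide_eq_true_iff] at hi
    exact Finset.mem_image.2 ⟨i, Finset.mem_range.2 hi.2, hys i x (testBit_maskOf hi.1)⟩
  have hcard : S.card + ∑ x, absent D (maskOf x ys) = 5 := by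
    rw [Finset.card_filter, ← Finset.sum_add_distrib,
      Finset.sum_congr rfl (g := fun _ => 1) fun x _ => ?_]
    · rfl
    · change _ + (1 - (maskOf x ys &&& (2 ^ D - 1))) = 1
      split_ifs <;> omega
  have himage : ((Finset.range D).image fun i => z (n - i)).card = (Finset.range D).card :=
    le_antisymm Finset.card_image_le (by
      have := Finset.card_le_card hS
      rw [Finset.card_range]
      omega)
  simpa [Set.InjOn] using Finset.card_image_iff.1 himage

theorem searchFrom_eq_false {z : ℕ → Letter} (hz : Avoids z) {D T : ℕ} (hD : NoDistinct z D T)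
    (fuel : ℕ) {n : ℕ} {ys : List Letter} (hn : T + 32 ≤ n) (hys : Reads z n ys) :
    searchFrom D fuel ys = false := by
  induction fuel generalizing n ys with
  | zero => rfl
  | succ fuel ih =>
    by_contra h
    rcases search_child (by simpa using h) (z n)
      (sims_and_testMask_eq_zero hz (by omega) hys fuel) with h | h
    · exact hD n (by omega) (injOn_of_blockedFrom hys.cons h)
    · exact absurd (ih (by omega) hys.cons) (by simp [h])

theorem exists_perm_apply_eq {α : Type*} {m : ℕ} (f g : Fin m ↪ α) :
    ∃ e : Equiv.Perm α, ∀ i, e (f i) = g i := by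
  have := Equiv.Perm.isMultiplyPretransitive α m
  obtain ⟨e, he⟩ := MulAction.exists_smul_eq (Equiv.Perm α) f g
  exact ⟨e, fun i => DFunLike.congr_fun he i⟩

theorem NoDistinct.of_search {z : ℕ → Letter} (hz : Avoids z) {D T fuel : ℕ}
    (hD : NoDistinct z D T) {ys : List Letter} (hys : ys.Nodup)
    (h : searchFrom D fuel ys = true) : NoDistinct z ys.length (T + 32) := by
  intro n hn hinj
  obtain ⟨e, he⟩ := exists_perm_apply_eq
    ⟨fun i : Fin ys.length => z (n - i), fun i j hij => Fin.ext (hinj i.2 j.2 hij)⟩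
    ⟨ys.get, List.nodup_iff_injective_get.1 hys⟩
  have hr : Reads (e ∘ z) (n + 1) ys := by
    intro j y hy
    obtain ⟨hj, rfl⟩ := List.getElem?_eq_some_iff.1 hy
    exact he ⟨j, hj⟩
  have := searchFrom_eq_false (hz.comp_equiv e) (hD.comp_equiv e) fuel (by omega) hr
  simp [h] at this

theorem searchFrom_five : searchFrom 6 60 [.e, .d, .c, .b, .a] = true := by decide +kernel

theorem searchFrom_four : searchFrom 5 60 [.d, .c, .b, .a] = true := by decide +kernel

theorem searchFrom_one : searchFrom 4 60 [.a] = true := by decide +kernel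

theorem noDistinct_six (z : ℕ → Letter) : NoDistinct z 6 0 := by
  intro n _ h
  have := Finset.card_le_univ ((Finset.range 6).image fun i => z (n - i))
  rw [Finset.card_image_of_injOn (by simpa [Set.InjOn] using h)] at this
  exact absurd this (by decide)

theorem not_avoids (z : ℕ → Letter) : ¬ Avoids z := by
  intro hz
  have h := (((noDistinct_six z).of_search hz (by decide) searchFrom_five).of_search hz (by decide)
    searchFrom_four).of_search hz (by decide) searchFrom_one
  exact h _ le_rfl fun i hi j hj _ => by simp_all

end SimilarWords

open SimilarWords in
/-- There is no infinite word over a 5-letter alphabet with similarity coefficient at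
most 0.590: every infinite word over Fin 5 has adjacent equal-length factors of some
length ℓ ≥ 1 admitting a common subsequence of length greater than 0.590·ℓ. -/
theorem no_infinite_word_fin5_similarity_le
    (z : ℕ → Fin 5) :
    ∃ (t ℓ : ℕ), 1 ≤ ℓ ∧
      ∃ w : List (Fin 5),
        w.Sublist ((List.range ℓ).map fun i => z (t + i)) ∧
        w.Sublist ((List.range ℓ).map fun i => z (t + ℓ + i)) ∧
        (0.590 : ℝ) * ℓ < (w.length : ℝ) := by
  by_contra! h
  have hz : Avoids z := fun t ℓ w hℓ hx hy => by
    have := h t ℓ hℓ w hx hy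
    have h' : (100 * w.length : ℝ) ≤ 59 * ℓ := by linarith
    exact_mod_cast h'
  exact not_avoids _ (hz.comp_equiv (Fintype.equivOfCardEq (β := Letter) rfl))
end

section
/- There is no infinite word over a 7-letter alphabet with similarity coefficient at most 0.450. Equivalently, for every infinite word z : ℕ → Fin 7 there exist t ≥ 0, ℓ ≥ 1, and a list w that is a common subsequence of the adjacent factors z(t)⋯z(t+ℓ−1) and z(t+ℓ)⋯z(t+2ℓ−1) with length of w strictly greater than 0.450·ℓ. -/
/-- Feeds the part of `ys` after the first occurrence of `x` to `k`; `false` if there is none.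
This and the next definitions use recursors and continuations so that the kernel evaluates them
quickly. -/
def afterFirst (x : ℕ) (k : List ℕ → Bool) (ys : List ℕ) : Bool :=
  List.rec (motive := fun _ => Bool) false
    (fun y ys ih => Bool.rec ih (k ys) (Nat.beq x y)) ys

/-- Whether deleting at most `s` letters of `xs` yields a subsequence of `ys`. -/
def isSublistUpTo (xs : List ℕ) : ℕ → List ℕ → Bool :=
  List.rec (motive := fun _ => ℕ → List ℕ → Bool) (fun _ _ => true)
    (fun x _ ih s ys =>
      Bool.rec (Nat.rec (motive := fun _ => Bool) false (fun s _ => ih s ys) s) true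
        (afterFirst x (ih s) ys)) xs

/-- Moves `l` letters from `p` onto `acc` in reverse order, then feeds `acc` and the remaining
letters to `k`; `false` if `p` is too short. -/
def splitReverse (k : List ℕ → List ℕ → Bool) (l : ℕ) : List ℕ → List ℕ → Bool :=
  Nat.rec (motive := fun _ => List ℕ → List ℕ → Bool) k
    (fun _ ih acc p =>
      List.rec (motive := fun _ => Bool) false (fun a p _ => ih (a :: acc) p) p) l

/-- Whether the word with reversal `p` ends in two adjacent factors of length `l` with a common
subsequence of length at least `l - s`. -/
def endsSimilar (l s : ℕ) (p : List ℕ) : Bool :=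
  splitReverse (fun y q => splitReverse (fun x _ => isSublistUpTo x s y) l [] q) l [] p

/-- Whether the word with reversal `p` ends in two adjacent factors, of one of the listed lengths,
of similarity exceeding `9 / 20`. -/
def endsForbidden (p : List ℕ) : Bool :=
  endsSimilar 1 0 p || (endsSimilar 2 1 p || (endsSimilar 4 2 p || (endsSimilar 6 3 p ||
    (endsSimilar 11 6 p || (endsSimilar 10 5 p || endsSimilar 8 4 p)))))

/-- Backtracking search: whether every extension by `n` letters of the word with reversal `p` has
a forbidden factor. The letters in `used` may occur in `p`; those in `fresh` do not, and are
introduced in order. -/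
def search : ℕ → List ℕ → List ℕ → List ℕ → Bool
  | 0, _, _, _ => false
  | n + 1, used, fresh, p =>
    used.all (fun c => endsForbidden (c :: p) || search n used fresh (c :: p)) &&
      match fresh with
      | [] => true
      | c :: fresh => endsForbidden (c :: p) || search n (c :: used) fresh (c :: p)

theorem exists_append_of_afterFirst {x : ℕ} {k : List ℕ → Bool} {ys : List ℕ}
    (h : afterFirst x k ys = true) : ∃ us vs, ys = us ++ x :: vs ∧ k vs = true := by
  induction ys with
  | nil => cases h
  | cons y ys ih =>
    change Bool.rec (afterFirst x k ys) (k ys) (Nat.beq x y) = true at h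
    cases hxy : Nat.beq x y with
    | true =>
      rw [hxy] at h
      exact ⟨[], ys, by rw [Nat.eq_of_beq_eq_true hxy]; rfl, h⟩
    | false =>
      rw [hxy] at h
      obtain ⟨us, vs, rfl, hk⟩ := ih h
      exact ⟨y :: us, vs, rfl, hk⟩

theorem exists_common_sublist_of_isSublistUpTo {xs : List ℕ} {s : ℕ} {ys : List ℕ}
    (h : isSublistUpTo xs s ys = true) :
    ∃ w : List ℕ, w.Sublist xs ∧ w.Sublist ys ∧ xs.length ≤ w.length + s := by
  induction xs generalizing s ys with
  | nil => exact ⟨[], by simp⟩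
  | cons x xs ih =>
    change Bool.rec (Nat.rec (motive := fun _ => Bool) false
      (fun s _ => isSublistUpTo xs s ys) s) true (afterFirst x (isSublistUpTo xs s) ys) = true at h
    cases hx : afterFirst x (isSublistUpTo xs s) ys with
    | true =>
      obtain ⟨us, vs, rfl, hk⟩ := exists_append_of_afterFirst hx
      obtain ⟨w, hwx, hwy, hw⟩ := ih hk
      exact ⟨x :: w, hwx.cons_cons x,
        (hwy.cons_cons x).trans (List.sublist_append_right us _), by simp; omega⟩
    | false =>
      rw [hx] at h
      cases s with
      | zero => cases h
      | succ s =>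
        obtain ⟨w, hwx, hwy, hw⟩ := ih h
        exact ⟨w, hwx.cons x, hwy, by simp; omega⟩

theorem splitReverse_eq_true {k : List ℕ → List ℕ → Bool} {l : ℕ} {acc p : List ℕ}
    (h : splitReverse k l acc p = true) :
    ∃ b r : List ℕ, p = b ++ r ∧ b.length = l ∧ k (b.reverse ++ acc) r = true := by
  induction l generalizing acc p with
  | zero => exact ⟨[], p, rfl, rfl, h⟩
  | succ l ih =>
    cases p with
    | nil => cases h
    | cons a p =>
      obtain ⟨b, r, rfl, hb, hk⟩ := ih (acc := a :: acc) (p := p) h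
      exact ⟨a :: b, r, rfl, by simp [hb], by simpa using hk⟩

theorem endsSimilar_eq_true {l s : ℕ} {p : List ℕ} (h : endsSimilar l s p = true) :
    ∃ x y r w : List ℕ, p = (r ++ x ++ y).reverse ∧ x.length = l ∧ y.length = l ∧
      w.Sublist x ∧ w.Sublist y ∧ l ≤ w.length + s := by
  obtain ⟨y, q, rfl, hy, hq⟩ := splitReverse_eq_true h
  obtain ⟨x, r, rfl, hx, hr⟩ := splitReverse_eq_true hq
  obtain ⟨w, hwx, hwy, hw⟩ := exists_common_sublist_of_isSublistUpTo hr
  simp only [List.append_nil, List.length_reverse] at hwx hwy hw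
  exact ⟨x.reverse, y.reverse, r.reverse, w, by simp, by simpa using hx, by simpa using hy,
    hwx, hwy, hx ▸ hw⟩

theorem endsForbidden_eq_true {p : List ℕ} (h : endsForbidden p = true) :
    ∃ x y r w : List ℕ, p = (r ++ x ++ y).reverse ∧ x.length = y.length ∧ 1 ≤ y.length ∧
      w.Sublist x ∧ w.Sublist y ∧ 9 * y.length < 20 * w.length := by
  have key : ∀ l s : ℕ, 1 ≤ l → 20 * s < 11 * l → endsSimilar l s p = true →
      ∃ x y r w : List ℕ, p = (r ++ x ++ y).reverse ∧ x.length = y.length ∧ 1 ≤ y.length ∧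
        w.Sublist x ∧ w.Sublist y ∧ 9 * y.length < 20 * w.length := by
    intro l s hl hs hp
    obtain ⟨x, y, r, w, hp, hx, hy, hwx, hwy, hw⟩ := endsSimilar_eq_true hp
    exact ⟨x, y, r, w, hp, by omega, by omega, hwx, hwy, by omega⟩
  simp only [endsForbidden, Bool.or_eq_true] at h
  rcases h with h | h | h | h | h | h | h <;> exact key _ _ (by norm_num) (by norm_num) h

/-- The property of the infinite word `z` asserted by the main theorem. -/
def HasSimilarFactors (z : ℕ → Fin 7) : Prop :=
  ∃ (t ℓ : ℕ), 1 ≤ ℓ ∧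
    ∃ w : List (Fin 7),
      w.Sublist ((List.range ℓ).map fun i => z (t + i)) ∧
      w.Sublist ((List.range ℓ).map fun i => z (t + ℓ + i)) ∧
      (0.450 : ℝ) * ℓ < (w.length : ℝ)

/-- If some letter-to-letter image of the word with reversal `p` is a prefix of `z`, then a
forbidden factor of the former yields one of `z`. -/
theorem hasSimilarFactors_of_endsForbidden {z : ℕ → Fin 7} {g : ℕ → Fin 7} {p : List ℕ}
    (hp : p.reverse.map g = (List.range p.length).map z) (h : endsForbidden p = true) :
    HasSimilarFactors z := by
  obtain ⟨x, y, r, w, rfl, hxy, hy, hwx, hwy, hw⟩ := endsForbidden_eq_true h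
  simp only [List.reverse_reverse, List.length_reverse, List.length_append, List.map_append,
    List.range_add, List.map_map] at hp
  obtain ⟨hp, hpy⟩ := List.append_inj hp (by simp)
  obtain ⟨-, hpx⟩ := List.append_inj hp (by simp)
  refine ⟨r.length, y.length, hy, w.map g, ?_, ?_, ?_⟩
  · rw [hxy] at hpx
    exact hpx ▸ hwx.map g
  · rw [hxy] at hpy
    exact hpy ▸ hwy.map g
  · have : (9 * y.length : ℝ) < 20 * w.length := by exact_mod_cast hw
    rw [List.length_map]
    linarith

theorem hasSimilarFactors_of_search {z : ℕ → Fin 7} {n : ℕ} {used fresh p : List ℕ}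
    {g : ℕ → Fin 7} (h : search n used fresh p = true)
    (hp : p.reverse.map g = (List.range p.length).map z) (hused : p ⊆ used)
    (hnodup : (used ++ fresh).Nodup) (hg : ∀ a, ∃ c ∈ used ++ fresh, g c = a) :
    HasSimilarFactors z := by
  induction n generalizing used fresh p g with
  | zero => cases h
  | succ n ih =>
    have extend : ∀ {c : ℕ} {g' : ℕ → Fin 7}, g' c = z p.length →
        p.reverse.map g' = (List.range p.length).map z →
        (c :: p).reverse.map g' = (List.range (c :: p).length).map z := by
      intro c g' hc hp'
      simp [List.range_succ, ← hp', hc]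
    simp only [search, Bool.and_eq_true, List.all_eq_true, Bool.or_eq_true] at h
    obtain ⟨hold, hnew⟩ := h
    obtain ⟨c, hc, hgc⟩ := hg (z p.length)
    rcases List.mem_append.1 hc with hcu | hcf
    · rcases hold c hcu with hbad | hrec
      · exact hasSimilarFactors_of_endsForbidden (extend hgc hp) hbad
      · exact ih hrec (extend hgc hp) (by simp [hcu, hused]) hnodup hg
    · cases fresh with
      | nil => cases hcf
      | cons d fresh =>
        have hdisj := List.disjoint_of_nodup_append hnodup
        have hd : (g ∘ Equiv.swap c d) d = z p.length := by simp [hgc]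
        have hp' : p.reverse.map (g ∘ Equiv.swap c d) = (List.range p.length).map z := by
          rw [← hp]
          refine List.map_congr_left fun a ha => ?_
          have hau := hused (List.mem_reverse.1 ha)
          rw [Function.comp_apply, Equiv.swap_apply_of_ne_of_ne]
          · rintro rfl
            exact hdisj hau hcf
          · rintro rfl
            exact hdisj hau List.mem_cons_self
        rcases Bool.or_eq_true _ _ ▸ hnew with hbad | hrec
        · exact hasSimilarFactors_of_endsForbidden (extend hd hp') hbad
        · have hperm : (d :: used ++ fresh).Perm (used ++ d :: fresh) := List.perm_middle.symm
          refine ih hrec (extend hd hp') (List.cons_subset_cons d hused)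
            (hperm.nodup_iff.2 hnodup) fun a => ?_
          obtain ⟨b, hb, rfl⟩ := hg a
          refine ⟨Equiv.swap c d b, hperm.mem_iff.2 ?_, by simp⟩
          rw [Equiv.swap_apply_def]
          split_ifs
          · simp
          · exact hc
          · exact hb

theorem search_empty_word : search 24 [] [0, 1, 2, 3, 4, 5, 6] [] = true := by
  decide +kernel

/-- There is no infinite word over a 7-letter alphabet with similarity coefficient at
most 0.450: every infinite word over Fin 7 has adjacent equal-length factors of some
length ℓ ≥ 1 admitting a common subsequence of length greater than 0.450·ℓ. -/
theorem no_infinite_word_fin7_similarity_le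
    (z : ℕ → Fin 7) :
    ∃ (t ℓ : ℕ), 1 ≤ ℓ ∧
      ∃ w : List (Fin 7),
        w.Sublist ((List.range ℓ).map fun i => z (t + i)) ∧
        w.Sublist ((List.range ℓ).map fun i => z (t + ℓ + i)) ∧
        (0.450 : ℝ) * ℓ < (w.length : ℝ) := by
  exact hasSimilarFactors_of_search (g := fun c => Fin.ofNat 7 c) search_empty_word rfl
    (List.nil_subset _) (by decide) (by decide)
end

section
/- There is no infinite word over an 8-letter alphabet with similarity coefficient at most 0.400. Equivalently, for every infinite word z : ℕ → Fin 8 there exist t ≥ 0, ℓ ≥ 1, and a list w that is a common subsequence of the adjacent factors z(t)⋯z(t+ℓ−1) and z(t+ℓ)⋯z(t+2ℓ−1) with length of w strictly greater than 0.400·ℓ. -/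
open scoped List

namespace SimilarityBound

variable {α : Type*}

/-! ### Bit-parallel longest common subsequences -/

/-- `a` and `b` have a common subsequence of length `n`. -/
def CommonSub (n : ℕ) (a b : List α) : Prop := ∃ w : List α, w.length = n ∧ w <+ a ∧ w <+ b

theorem CommonSub.mono {n : ℕ} {a a' b b' : List α} (h : CommonSub n a b) (ha : a <+ a')
    (hb : b <+ b') : CommonSub n a' b' :=
  let ⟨w, hw, h₁, h₂⟩ := h
  ⟨w, hw, h₁.trans ha, h₂.trans hb⟩

theorem CommonSub.concat {n : ℕ} {a b : List α} (h : CommonSub n a b) (x : α) :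
    CommonSub (n + 1) (a ++ [x]) (b ++ [x]) :=
  let ⟨w, hw, h₁, h₂⟩ := h
  ⟨w ++ [x], by simp [hw], h₁.append_right [x], h₂.append_right [x]⟩

/-- The bits of `V`, lowest first, encode lower bounds for the length of common subsequences of `b`
with the prefixes of `u ++ a` that extend `u`, starting from `n`: the bound grows by one at each zero
bit. The bits past `a` repeat the final bound in unary. -/
def EncodesRow (b : List α) : List α → ℕ → List α → ℕ → Prop
  | u, n, [], V => CommonSub n u b ∧ V + 1 = 2 ^ n
  | u, n, x :: a, V => CommonSub n u b ∧ EncodesRow b (u ++ [x]) (n + 1 - V % 2) a (V / 2)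

theorem EncodesRow.commonSub {b u a : List α} {n V : ℕ} (h : EncodesRow b u n a V) :
    CommonSub n u b := by
  cases a <;> exact h.1

theorem encodesRow_nil (u a : List α) : EncodesRow [] u 0 a (2 ^ a.length - 1) := by
  induction a generalizing u with
  | nil => exact ⟨⟨[], by simp⟩, by simp⟩
  | cons x a ih =>
    refine ⟨⟨[], by simp⟩, ?_⟩
    have hp : 0 < 2 ^ a.length := by positivity
    have h₁ : 0 + 1 - (2 ^ (x :: a).length - 1) % 2 = 0 := by
      rw [List.length_cons, pow_succ]; omega
    have h₂ : (2 ^ (x :: a).length - 1) / 2 = 2 ^ a.length - 1 := by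
      rw [List.length_cons, pow_succ]; omega
    rw [h₁, h₂]
    exact ih _

/-- One update of the bit-parallel algorithm for longest common subsequences. -/
def lcsStep (V U : ℕ) : ℕ := Nat.lor (Nat.add V U) (Nat.sub V U)

theorem EncodesRow.step {b u a : List α} {n V M c : ℕ} {y : α} (hc : c ≤ 1)
    (h : EncodesRow b u n a V) (hu : CommonSub (n + c) u (b ++ [y]))
    (hM : ∀ i, M.testBit i → a[i]? = some y) :
    EncodesRow (b ++ [y]) u (n + c) a ((V + (V &&& M) + c) ||| (V - (V &&& M))) := by
  induction a generalizing u n V M c with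
  | nil =>
    have hM0 : M = 0 := Nat.eq_of_testBit_eq fun i => by
      simpa using fun hi => hM i hi
    refine ⟨hu, ?_⟩
    have hV := h.2
    subst hM0
    obtain rfl | rfl : c = 0 ∨ c = 1 := by omega
    · simpa using hV
    · have hlt : V < 2 ^ n := by omega
      rw [Nat.and_zero, Nat.add_zero, Nat.sub_zero, hV]
      have := Nat.two_pow_add_eq_or_of_lt hlt 1
      rw [mul_one] at this
      rw [← this, pow_succ]
      omega
  | cons x a ih =>
    obtain ⟨hn, ht⟩ := h
    refine ⟨hu, ?_⟩
    have hU : V &&& M ≤ V := Nat.and_le_left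
    have hU2 : (V &&& M) / 2 = (V / 2) &&& (M / 2) := Nat.and_div_two
    have hUm : (V &&& M) % 2 = (V % 2) &&& (M % 2) := by
      simpa using Nat.and_mod_two_pow (a := V) (b := M) (n := 1)
    have hM' : ∀ i, (M / 2).testBit i → a[i]? = some y := fun i hi => by
      simpa using hM (i + 1) (by rwa [Nat.testBit_succ])
    have hx : M % 2 = 1 → x = y := fun h1 => by
      simpa using hM 0 (by simpa using h1)
    set U := V &&& M with hUdef
    have horm : ∀ s t : ℕ, (s ||| t) % 2 = s % 2 ||| t % 2 := fun s t => by
      simpa using Nat.or_mod_two_pow (a := s) (b := t) (n := 1)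
    have key : ∀ c' ≤ 1, (V + U + c) / 2 = V / 2 + U / 2 + c' →
        (V - U) / 2 = V / 2 - U / 2 → 
        n + c + 1 - ((V + U + c) % 2 ||| (V - U) % 2) = n + 1 - V % 2 + c' →
        CommonSub (n + 1 - V % 2 + c') (u ++ [x]) (b ++ [y]) →
        EncodesRow (b ++ [y]) (u ++ [x]) (n + c + 1 - ((V + U + c) ||| (V - U)) % 2) a
          (((V + U + c) ||| (V - U)) / 2) := by
      intro c' hc' h₁ h₂ h₃ h₄
      rw [Nat.or_div_two, horm, h₁, h₂, h₃, hU2]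
      exact ih hc' ht h₄ hM'
    rcases Nat.mod_two_eq_zero_or_one V with hv | hv
    · have hu0 : U % 2 = 0 := by rw [hUm, hv]; simp
      refine key 0 (by omega) (by omega) (by omega) ?_ ?_
      · obtain rfl | rfl : c = 0 ∨ c = 1 := by omega
        · have h1 : (V + U + 0) % 2 = 0 := by omega
          have h2 : (V - U) % 2 = 0 := by omega
          rw [h1, h2, hv]; rfl
        · have h1 : (V + U + 1) % 2 = 1 := by omega
          have h2 : (V - U) % 2 = 0 := by omega
          rw [h1, h2, hv]; rfl
      · exact ht.commonSub.mono (.refl _) (List.sublist_append_left _ _)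
    · rcases Nat.mod_two_eq_zero_or_one M with hm | hm
      · have hu0 : U % 2 = 0 := by rw [hUm, hm]; simp
        refine key c hc (by omega) (by omega) ?_ ?_
        · have h2 : (V - U) % 2 = 1 := by omega
          obtain h1 | h1 := Nat.mod_two_eq_zero_or_one (V + U + c) <;>
          · rw [h1, h2, hv]
            norm_num
        · rw [hv]
          exact hu.mono (List.sublist_append_left _ _) (.refl _)
      · have hu1 : U % 2 = 1 := by rw [hUm, hv, hm]; simp
        obtain rfl := hx hm
        refine key 1 le_rfl (by omega) (by omega) ?_ ?_
        · have h2 : (V - U) % 2 = 0 := by omega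
          obtain rfl | rfl : c = 0 ∨ c = 1 := by omega
          · have h1 : (V + U + 0) % 2 = 0 := by omega
            rw [h1, h2, hv]; rfl
          · have h1 : (V + U + 1) % 2 = 1 := by omega
            rw [h1, h2, hv]; rfl
        · rw [hv]
          exact hn.concat x

theorem EncodesRow.exists_commonSub {b u a : List α} {n V k : ℕ} (h : EncodesRow b u n a V)
    (hV : 2 ^ (a.length + k) ≤ V) : ∃ l, k < l ∧ CommonSub l (u ++ a) b := by
  induction a generalizing u n V with
  | nil =>
    refine ⟨n, ?_, by simpa using h.1⟩
    rw [← Nat.pow_lt_pow_iff_right (a := 2) (by norm_num), ← h.2]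
    simpa using Nat.lt_succ_of_le hV
  | cons x a ih =>
    obtain ⟨l, hl, hs⟩ := ih h.2 (by
      rw [Nat.le_div_iff_mul_le (by norm_num), ← pow_succ]
      convert hV using 2
      simp; omega)
    exact ⟨l, hl, by simpa using hs⟩

/-! ### The search

The definitions use recursors and continuations so that the kernel evaluates them quickly. -/

/-- `k n`, with `n` evaluated first. -/
noncomputable def forceNat {β : Type} (n : ℕ) (k : ℕ → β) : β :=
  Nat.rec (k 0) (fun p _ => k (Nat.succ p)) n

@[simp]
theorem forceNat_eq {β : Type} (n : ℕ) (k : ℕ → β) : forceNat n k = k n := by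
  cases n <;> rfl

/-- `k (l ++ [c])`, with the list evaluated first. -/
noncomputable def appendThen {β : Type} (l : List ℕ) (c : ℕ) : (List ℕ → β) → β :=
  List.rec (fun k => k [c]) (fun x _ ih k => ih fun l => k (x :: l)) l

@[simp]
theorem appendThen_eq {β : Type} (l : List ℕ) (c : ℕ) (k : List ℕ → β) :
    appendThen l c k = k (l ++ [c]) := by
  induction l generalizing k with
  | nil => rfl
  | cons x l ih => exact ih _

/-- `k (l.filter f)`, with the list evaluated first. -/
noncomputable def filterThen {β : Type} (f : ℕ → Bool) (l : List ℕ) : (List ℕ → β) → β :=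
  List.rec (fun k => k [])
    (fun c _ ih k => Bool.rec (ih k) (ih fun l => k (c :: l)) (f c)) l

@[simp]
theorem filterThen_eq {β : Type} (f : ℕ → Bool) (l : List ℕ) (k : List ℕ → β) :
    filterThen f l k = k (l.filter f) := by
  induction l generalizing k with
  | nil => rfl
  | cons c l ih =>
    change Bool.rec (motive := fun _ => β) (filterThen f l k)
      (filterThen f l fun l => k (c :: l)) (f c) = _
    cases hc : f c <;> simp [hc, ih]

/-- Bit `i + 64 * (c + 1)` is set if the letter of `p` at `i` is `c`. -/
noncomputable def letterMask (p : List ℕ) : ℕ :=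
  List.rec 0 (fun c _ ih => Nat.lor (Nat.pow 2 (Nat.mul 64 (Nat.succ c))) (Nat.mul 2 ih)) p

theorem getElem?_of_testBit_letterMask {p : List ℕ} {j : ℕ} (h : (letterMask p).testBit j) :
    ∃ i c, p[i]? = some c ∧ j = i + 64 * (c + 1) := by
  induction p generalizing j with
  | nil => simp [letterMask] at h
  | cons x p ih =>
    change (2 ^ (64 * (x + 1)) ||| 2 * letterMask p).testBit j = true at h
    rw [Nat.testBit_or, Bool.or_eq_true, Nat.testBit_two_pow, decide_eq_true_iff] at h
    rcases h with rfl | h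
    · exact ⟨0, x, by simp⟩
    · cases j with
      | zero => simp at h
      | succ j =>
        rw [Nat.testBit_succ, Nat.mul_div_cancel_left _ two_pos] at h
        obtain ⟨i, c, hc, rfl⟩ := ih h
        exact ⟨i + 1, c, by simpa using hc, by ring⟩

/-- The low bits hold a residue, so that distinct tables have distinct low words. -/
noncomputable def letterTable (p : List ℕ) : ℕ :=
  forceNat (letterMask p) fun P => Nat.lor P (Nat.mod P 1000000007)

/-- The occurrences of `c` from position `o` on, cut off by the mask `s`. -/
def window (P o s c : ℕ) : ℕ :=
  Nat.land (Nat.shiftRight P (Nat.add o (Nat.mul 64 (Nat.succ c)))) s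

theorem getElem?_of_testBit_window {p : List ℕ} {o l c i : ℕ} (hp : p.length ≤ 64)
    (hl : o + l ≤ 64) (h : (window (letterTable p) o (2 ^ l - 1) c).testBit i) :
    i < l ∧ p[o + i]? = some c := by
  have hw : window (letterTable p) o (2 ^ l - 1) c =
      (letterMask p ||| letterMask p % 1000000007) >>> (o + 64 * (c + 1)) &&& (2 ^ l - 1) := by
    simp only [letterTable, forceNat_eq]; rfl
  rw [hw, Nat.testBit_and, Nat.testBit_shiftRight, Nat.testBit_two_pow_sub_one, Nat.testBit_or,
    Bool.and_eq_true, decide_eq_true_iff, Bool.or_eq_true] at h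
  obtain ⟨h | h, hi⟩ := h
  · obtain ⟨j, c', hj, he⟩ := getElem?_of_testBit_letterMask h
    have hjlt : j < p.length := (List.getElem?_eq_some_iff.1 hj).1
    obtain rfl : c' = c := by omega
    obtain rfl : j = o + i := by omega
    exact ⟨hi, hj⟩
  · have hlt : letterMask p % 1000000007 < 2 ^ (o + 64 * (c + 1) + i) :=
      (Nat.mod_lt _ (by norm_num)).trans_le <| (by norm_num : 1000000007 ≤ 2 ^ 64).trans
        (Nat.pow_le_pow_right two_pos (by omega))
    rw [Nat.testBit_lt_two_pow hlt] at h
    cases h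

/-- The bit row after reading the letters of `b`. -/
noncomputable def lcsRow (P o s : ℕ) (b : List ℕ) : ℕ → ℕ :=
  List.rec (fun V => V)
    (fun c _ ih V => forceNat (lcsStep V (Nat.land V (window P o s c))) ih) b

theorem EncodesRow.lcsRow {P o s : ℕ} {a : List ℕ}
    (hw : ∀ c i, (window P o s c).testBit i → a[i]? = some c) (b : List ℕ) {b' : List ℕ} {V : ℕ}
    (h : EncodesRow b' [] 0 a V) : EncodesRow (b' ++ b) [] 0 a (lcsRow P o s b V) := by
  induction b generalizing b' V with
  | nil => rw [List.append_nil]; exact h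
  | cons c b ih =>
    have hs := h.step (c := 0) (y := c) zero_le_one ⟨[], by simp⟩ (hw c)
    have := ih hs
    rw [List.append_assoc] at this
    change EncodesRow _ [] 0 a (forceNat _ _)
    rw [forceNat_eq]
    exact this

/-- No adjacent equal-length factors of `v` have similarity above two fifths. -/
def Sparse (v : List α) : Prop :=
  ∀ x y : List α, x.length = y.length → x ++ y <:+: v → ∀ l, CommonSub l x y → 5 * l ≤ 2 * x.length

/-- Discards from `cs` the letters that complete two too similar adjacent factors of length at least
`l` at the end of a word with table `P` and length `n - 1`; `b` holds its last `l - 1` letters and `q`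
the other ones, reversed. -/
noncomputable def sieve (P n : ℕ) (q : List ℕ) : ℕ → List ℕ → List ℕ → List ℕ :=
  List.rec (fun _ _ cs => cs)
    (fun c _ ih l b cs => List.rec [] (fun _ _ _ => Bool.rec cs
      (forceNat (Nat.sub n (Nat.mul 2 l)) fun o =>
        forceNat (Nat.sub (Nat.pow 2 l) 1) fun s =>
        forceNat (lcsRow P o s b s) fun V =>
        filterThen (fun c => Nat.blt (Nat.add V (Nat.land V (window P o s c)))
            (Nat.pow 2 (Nat.add l (Nat.div (Nat.mul 2 l) 5)))) cs
          (ih (Nat.succ l) (c :: b)))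
      (Nat.ble (Nat.mul 2 l) n)) cs) q

theorem sieve_cons (P n c : ℕ) (q : List ℕ) (l : ℕ) (b cs : List ℕ) (hcs : cs ≠ []) :
    sieve P n (c :: q) l b cs = if 2 * l ≤ n then
      sieve P n q (l + 1) (c :: b) (cs.filter fun x =>
        decide (lcsRow P (n - 2 * l) (2 ^ l - 1) b (2 ^ l - 1) +
          (lcsRow P (n - 2 * l) (2 ^ l - 1) b (2 ^ l - 1) &&& window P (n - 2 * l) (2 ^ l - 1) x)
            < 2 ^ (l + 2 * l / 5))) else cs := by
  obtain ⟨x, cs, rfl⟩ := List.exists_cons_of_ne_nil hcs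
  split_ifs with h
  · change Bool.rec (motive := fun _ => List ℕ) _ _ (Nat.ble (2 * l) n) = _
    rw [Nat.ble_eq_true_of_le h]
    dsimp only
    rw [forceNat_eq, forceNat_eq, forceNat_eq, filterThen_eq]
    change sieve P n q (l + 1) (c :: b) _ = _
    congr 2
    funext x
    rw [Bool.eq_iff_iff, decide_eq_true_iff, Nat.blt_eq]
    rfl
  · change Bool.rec (motive := fun _ => List ℕ) _ _ (Nat.ble (2 * l) n) = _
    have : Nat.ble (2 * l) n = false := by
      rw [← Bool.not_eq_true, Nat.ble_eq]; exact h
    rw [this]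

theorem mem_sieve {p : List ℕ} {c : ℕ} (hp : p.length < 64) (hs : Sparse (p ++ [c]))
    {q b cs : List ℕ} {l : ℕ} (hl : 0 < l) (hb : b.length + 1 = l) (hq : p = q.reverse ++ b)
    (hc : c ∈ cs) : c ∈ sieve (letterTable p) (p.length + 1) q l b cs := by
  induction q generalizing l b cs with
  | nil => exact hc
  | cons e q ih =>
    rw [sieve_cons _ _ _ _ _ _ _ (List.ne_nil_of_mem hc)]
    split_ifs with hn
    · refine ih (by omega) (by simp [hb]) (by simp [hq]) (List.mem_filter.2 ⟨hc, ?_⟩)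
      rw [decide_eq_true_iff]
      by_contra! hlt
      set o := p.length + 1 - 2 * l with ho
      set a := (p.drop o).take l with ha
      have hlen := congrArg List.length hq
      rw [List.length_append] at hlen
      have hsplit : p = p.take o ++ (a ++ b) := by
        have hb' : (p.drop o).drop l = b := by
          rw [List.drop_drop, hq, List.drop_append_of_le_length (by omega), List.drop_of_length_le]
          · simp
          · omega
        rw [ha, ← hb', List.take_append_drop, List.take_append_drop]
      have hal : a.length = l := by
        rw [ha, List.length_take, List.length_drop]; omega
      have hw : ∀ c i, (window (letterTable p) o (2 ^ l - 1) c).testBit i → a[i]? = some c := by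
        intro c i h
        obtain ⟨hi, hi'⟩ := getElem?_of_testBit_window hp.le (by omega) h
        rw [ha, List.getElem?_take_of_lt hi, List.getElem?_drop, hi']
      have hrow := (encodesRow_nil [] a).lcsRow hw b
      rw [hal] at hrow
      have hlast := hrow.step (c := 0) (y := c) zero_le_one ⟨[], by simp⟩ (hw c)
      obtain ⟨r, hr, hcom⟩ := hlast.exists_commonSub (k := 2 * l / 5)
        (by rw [hal]; exact hlt.trans Nat.left_le_or)
      have := hs a (b ++ [c]) (by simp [hal, hb]) ⟨p.take o, [], by
        conv_rhs => rw [hsplit]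
        simp⟩ r (by simpa using hcom)
      omega
    · exact hc

/-- The numbers below `n`, in descending order. -/
noncomputable def rangeTo (n : ℕ) : List ℕ := Nat.rec [] (fun p ih => p :: ih) n

theorem rangeTo_eq (n : ℕ) : rangeTo n = (List.range n).reverse := by
  induction n with
  | zero => rfl
  | succ n ih => rw [List.range_succ, List.reverse_append, ← ih]; rfl

/-- The labels, among the `m` used ones and a fresh one, that can follow the word `p` of length `n`
and reversal `q`. -/
noncomputable def survivors (d m n : ℕ) (p q : List ℕ) : List ℕ :=
  forceNat (letterTable p) fun P =>
  filterThen (fun c => Nat.beq (window P (Nat.sub (Nat.succ n) d)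
      (Nat.sub (Nat.pow 2 (Nat.sub d 1)) 1) c) 0)
    (rangeTo (Bool.rec 8 (Nat.succ m) (Nat.ble m 7)))
  (List.rec (fun cs => cs) (fun x q _ => List.rec (fun cs => cs)
    (fun y q _ => sieve P (Nat.succ n) q 3 [y, x]) q) q)

/-- Equal letters of `v` are at distance at least `d`. -/
def Spread (d : ℕ) (v : List α) : Prop :=
  ∀ i j a, i < j → j < i + d → v[i]? = some a → v[j]? ≠ some a

theorem mem_survivors {d m c : ℕ} {p : List ℕ} (hd : 0 < d) (hdp : d ≤ p.length + 1)
    (hp : p.length < 64) (hs : Sparse (p ++ [c])) (hsp : Spread d (p ++ [c])) (hcm : c ≤ m) (hc : c < 8) :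
    c ∈ survivors d m p.length p p.reverse := by
  have hmem : c ∈ (rangeTo (Bool.rec 8 (Nat.succ m) (Nat.ble m 7))).filter fun c =>
      Nat.beq (window (letterTable p) (p.length + 1 - d) (2 ^ (d - 1) - 1) c) 0 := by
    rw [List.mem_filter, rangeTo_eq, List.mem_reverse, List.mem_range]
    constructor
    · cases Nat.ble m 7
      · exact hc
      · exact Nat.lt_succ_of_le hcm
    · rw [Nat.beq_eq]
      refine Nat.eq_of_testBit_eq fun i => ?_
      rw [Nat.zero_testBit, ← Bool.not_eq_true]
      intro h
      obtain ⟨hi, hi'⟩ := getElem?_of_testBit_window hp.le (by omega) h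
      have hlt := (List.getElem?_eq_some_iff.1 hi').1
      refine hsp _ p.length c hlt (by omega) ?_ (by simp)
      rwa [List.getElem?_append_left hlt]
  unfold survivors
  rw [forceNat_eq, filterThen_eq]
  rcases hq : p.reverse with - | ⟨x, - | ⟨y, q⟩⟩
  · exact hmem
  · exact hmem
  · have hpq : p = q.reverse ++ [y, x] := by
      rw [← List.reverse_reverse p, hq]; simp
    exact mem_sieve hp hs (by norm_num) rfl hpq hmem

/-- The number of used labels after `c` has been used. -/
noncomputable def bumped (m c : ℕ) : ℕ := Bool.rec (Nat.succ c) m (Nat.blt c m)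

/-- Passes the hint through the branches in turn. -/
noncomputable def thread (f : ℕ → ℕ → ℕ) (cs : List ℕ) : ℕ → ℕ :=
  List.rec (fun h => h) (fun c _ ih h => forceNat (f c h) ih) cs

theorem thread_cons (f : ℕ → ℕ → ℕ) (c : ℕ) (cs : List ℕ) (h : ℕ) :
    thread f (c :: cs) h = thread f cs (f c h) := by
  change forceNat _ _ = _
  rw [forceNat_eq]; rfl

theorem thread_zero {f : ℕ → ℕ → ℕ} (hf : ∀ c, f c 0 = 0) (cs : List ℕ) : thread f cs 0 = 0 := by
  induction cs with
  | nil => rfl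
  | cons c cs ih => rw [thread_cons, hf, ih]

theorem thread_eq_zero {f : ℕ → ℕ → ℕ} (hf : ∀ c, f c 0 = 0) {cs : List ℕ} {c : ℕ} (hc : c ∈ cs)
    (hfc : ∀ h, f c h = 0) (h : ℕ) : thread f cs h = 0 := by
  induction cs generalizing h with
  | nil => cases hc
  | cons e cs ih =>
    rw [thread_cons]
    rcases List.mem_cons.1 hc with rfl | hc
    · rw [hfc, thread_zero hf]
    · exact ih hc _

/-- Nonzero if the word `p` of length `n` and reversal `q` cannot be extended by `fuel` letters on
both sides. The binary digits of the hint `h` tell on which side to extend; the remaining hint is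
returned. -/
noncomputable def refute (d fuel : ℕ) : ℕ → ℕ → List ℕ → List ℕ → ℕ → ℕ :=
  Nat.rec (fun _ _ _ _ _ => 0)
    (fun _ ih m n p q h =>
      Bool.rec (motive := fun _ => (List ℕ → List ℕ → ℕ) → ℕ) (fun k => k q p) (fun k => k p q)
        (Nat.beq (Nat.mod h 2) 0) fun p q =>
      thread (fun c h => appendThen p c fun p =>
          forceNat (bumped m c) fun m => ih m (Nat.succ n) p (c :: q) h)
        (survivors d m n p q) (Nat.div h 2)) fuel

/-- The branch of `refute` that appends the label `c`. -/
noncomputable def extend (d fuel m n : ℕ) (p q : List ℕ) (c h : ℕ) : ℕ :=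
  refute d fuel (bumped m c) (n + 1) (p ++ [c]) (c :: q) h

theorem refute_succ (d fuel m n : ℕ) (p q : List ℕ) (h : ℕ) :
    refute d (fuel + 1) m n p q h = if h % 2 = 0
      then thread (extend d fuel m n p q) (survivors d m n p q) (h / 2)
      else thread (extend d fuel m n q p) (survivors d m n q p) (h / 2) := by
  have hb : (Nat.beq (Nat.mod h 2) 0) = decide (h % 2 = 0) := by
    rw [Bool.eq_iff_iff, Nat.beq_eq, decide_eq_true_iff]; rfl
  have he : ∀ p q, (fun c h => appendThen p c fun p => forceNat (bumped m c) fun m =>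
      refute d fuel m (n + 1) p (c :: q) h) = extend d fuel m n p q := fun p q => by
    funext c h
    simp [extend]
  rw [← he, ← he]
  change Bool.rec (motive := fun _ => (List ℕ → List ℕ → ℕ) → ℕ) _ _
    (Nat.beq (Nat.mod h 2) 0) _ = _
  rw [hb]
  by_cases h2 : h % 2 = 0
  · rw [if_pos h2, decide_eq_true h2]; rfl
  · rw [if_neg h2, decide_eq_false h2]; rfl

theorem refute_hint_zero (d fuel m n : ℕ) (p q : List ℕ) : refute d fuel m n p q 0 = 0 := by
  induction fuel generalizing m n p q with
  | zero => rfl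
  | succ fuel ih =>
    rw [refute_succ]
    exact thread_zero (fun c => ih _ _ _ _) _

/-- Whether the search excludes a repetition at distance exactly `d`. -/
noncomputable def refuteDistance (d h : ℕ) : Bool :=
  appendThen (List.range d) 0 fun p =>
  Nat.blt 0 (refute d 32 d (Nat.succ d) p (0 :: rangeTo d) h)

/-! ### Soundness for infinite words -/

/-- The factor of `z` of length `n` at `t`. -/
def factor (z : ℕ → α) (t n : ℕ) : List α := (List.range n).map fun i => z (t + i)

theorem factor_succ (z : ℕ → α) (t n : ℕ) : factor z t (n + 1) = factor z t n ++ [z (t + n)] := by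
  simp [factor, List.range_succ]

theorem factor_succ' (z : ℕ → α) (t n : ℕ) : factor z t (n + 1) = z t :: factor z (t + 1) n := by
  simp [factor, List.range_succ_eq_map, Function.comp_def, add_assoc, add_comm 1]

theorem getElem?_factor (z : ℕ → α) (t n i : ℕ) :
    (factor z t n)[i]? = if i < n then some (z (t + i)) else none := by
  simp [factor]
  split_ifs <;> simp_all

theorem Sparse.reverse {v : List α} (h : Sparse v) : Sparse v.reverse := by
  rintro x y hxy hv l ⟨w, hw, h₁, h₂⟩
  have := h y.reverse x.reverse (by simp [hxy])
    (by rw [← List.reverse_append]; exact List.reverse_infix.1 (by simpa using hv)) l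
    ⟨w.reverse, by simp [hw], h₂.reverse, h₁.reverse⟩
  simpa [hxy] using this

theorem Spread.reverse {d : ℕ} {v : List α} (h : Spread d v) : Spread d v.reverse := by
  intro i j a hij hjd hi hj
  have hil := (List.getElem?_eq_some_iff.1 hi).1
  have hjl := (List.getElem?_eq_some_iff.1 hj).1
  rw [List.length_reverse] at hil hjl
  rw [List.getElem?_reverse hil] at hi
  rw [List.getElem?_reverse hjl] at hj
  exact h _ _ a (by omega) (by omega) hj hi

theorem Sparse.of_map {β : Type*} {σ : β → α} {v : List β} (h : Sparse (v.map σ)) : Sparse v := by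
  rintro x y hxy ⟨s, t, rfl⟩ l ⟨w, hw, h₁, h₂⟩
  simpa using h (x.map σ) (y.map σ) (by simpa using hxy) ⟨s.map σ, t.map σ, by simp⟩ l
    ⟨w.map σ, by simpa using hw, h₁.map σ, h₂.map σ⟩

theorem Spread.of_map {β : Type*} {σ : β → α} {d : ℕ} {v : List β} (h : Spread d (v.map σ)) :
    Spread d v := fun i j a hij hjd hi hj =>
  h i j (σ a) hij hjd (by simp [hi]) (by simp [hj])

/-- Every letter is the image of an old label or of the first unused one. -/
theorem exists_label {σ : ℕ → Fin 8} {m : ℕ} (hσ : ((List.range m).map σ).Nodup) (x : Fin 8) :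
    ∃ c ≤ m, c < 8 ∧ ∃ τ : ℕ → Fin 8, τ c = x ∧ (∀ e < m, τ e = σ e) ∧ c < bumped m c ∧
      m ≤ bumped m c ∧ ((List.range (bumped m c)).map τ).Nodup := by
  have hm : m ≤ 8 := by simpa using hσ.length_le_card
  by_cases hx : x ∈ (List.range m).map σ
  · obtain ⟨c, hc, rfl⟩ := List.mem_map.1 hx
    rw [List.mem_range] at hc
    have hb : bumped m c = m := by
      unfold bumped
      rw [show Nat.blt c m = true by rwa [Nat.blt_eq]]
    exact ⟨c, hc.le, by omega, σ, rfl, fun _ _ => rfl, by omega, by omega, by rwa [hb]⟩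
  · have hb : bumped m m = m + 1 := by
      unfold bumped
      rw [show Nat.blt m m = false by rw [← Bool.not_eq_true, Nat.blt_eq]; exact lt_irrefl m]
    have hτ : ∀ e < m, Function.update σ m x e = σ e := fun e he =>
      Function.update_of_ne he.ne _ _
    have hnd : ((List.range (m + 1)).map (Function.update σ m x)).Nodup := by
      rw [List.range_succ, List.map_append,
        List.map_congr_left fun e he => hτ e (List.mem_range.1 he)]
      simpa [List.nodup_append, hσ] using hx
    have hm' : m + 1 ≤ 8 := by simpa using hnd.length_le_card
    exact ⟨m, le_rfl, hm', _, Function.update_self _ _ _, hτ, by omega, by omega, by rwa [hb]⟩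

theorem refute_eq_zero {z : ℕ → Fin 8} {d : ℕ} (hd : 0 < d) (hz : ∀ t n, Sparse (factor z t n))
    (hz' : ∀ t n, Spread d (factor z t n)) {fuel m : ℕ} {p : List ℕ} {t : ℕ} {σ : ℕ → Fin 8}
    (hσ : ((List.range m).map σ).Nodup) (hpm : ∀ e ∈ p, e < m) (hn : p.length + fuel ≤ 64)
    (hdp : d ≤ p.length + 1) (ht : fuel ≤ t)
    (hp : p.map σ = factor z t p.length ∨ p.reverse.map σ = factor z t p.length) (h : ℕ) :
    refute d fuel m p.length p p.reverse h = 0 := by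
  induction fuel generalizing m p t σ h with
  | zero => rfl
  | succ fuel ih =>
    have main : ∀ p : List ℕ, (∀ e ∈ p, e < m) → p.length + (fuel + 1) ≤ 64 →
        d ≤ p.length + 1 →
        (p.map σ = factor z t p.length ∨ p.reverse.map σ = factor z t p.length) → ∀ h,
        thread (extend d fuel m p.length p p.reverse) (survivors d m p.length p p.reverse) h
          = 0 := by
      clear hpm hn hdp hp h p
      intro p hpm hn hdp hp h
      obtain ⟨x, s, hs, hx⟩ : ∃ x s, fuel ≤ s ∧
          (p.map σ ++ [x] = factor z s (p.length + 1) ∨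
            x :: p.reverse.map σ = factor z s (p.length + 1)) := by
        rcases hp with hp | hp
        · exact ⟨z (t + p.length), t, by omega, .inl (by rw [hp, factor_succ])⟩
        · refine ⟨z (t - 1), t - 1, by omega, .inr ?_⟩
          rw [hp, factor_succ', Nat.sub_add_cancel (by omega)]
      obtain ⟨c, hcm, hc, τ, rfl, hτ, hcb, hmb, hnd⟩ := exists_label hσ x
      have hmap : p.map τ = p.map σ := List.map_congr_left fun e he => hτ e (hpm e he)
      have hx' : (p ++ [c]).map τ = factor z s (p ++ [c]).length ∨
          (p ++ [c]).reverse.map τ = factor z s (p ++ [c]).length := by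
        refine hx.imp (fun hx => ?_) fun hx => ?_
        · simpa [hmap] using hx
        · simpa [hmap, List.map_reverse] using hx
      have hSS : Sparse (p ++ [c]) ∧ Spread d (p ++ [c]) := by
        rcases hx' with hx | hx
        · exact ⟨.of_map (hx ▸ hz _ _), .of_map (hx ▸ hz' _ _)⟩
        · rw [← List.reverse_reverse (p ++ [c])]
          exact ⟨(Sparse.of_map (hx ▸ hz _ _)).reverse, (Spread.of_map (hx ▸ hz' _ _)).reverse⟩
      refine thread_eq_zero (fun c => refute_hint_zero _ _ _ _ _ _)
        (mem_survivors hd hdp (by omega) hSS.1 hSS.2 hcm hc) (fun h => ?_) h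
      have hrec := ih (p := p ++ [c]) hnd (fun e he => ?_) (by simp; omega) (by simp; omega)
        hs hx' h
      · simpa [extend] using hrec
      · rcases List.mem_append.1 he with he | he
        · exact (hpm e he).trans_le hmb
        · rwa [List.mem_singleton.1 he]
    rw [refute_succ]
    split_ifs
    · exact main p hpm hn hdp hp _
    · simpa using main p.reverse (by simpa using hpm) (by simpa using hn) (by simpa using hdp)
        (by simpa using hp.symm) (h / 2)

/-- Equal letters of the infinite word `z` are at distance at least `d`. -/
def Separated (d : ℕ) (z : ℕ → α) : Prop := ∀ i j, i < j → j < i + d → z i ≠ z j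

theorem Separated.spread {d : ℕ} {z : ℕ → α} (h : Separated d z) (t n : ℕ) :
    Spread d (factor z t n) := by
  intro i j a hij hjd hi hj
  rw [getElem?_factor] at hi hj
  split_ifs at hi hj
  exact h (t + i) (t + j) (by omega) (by omega)
    ((Option.some_inj.1 hi).trans (Option.some_inj.1 hj).symm)

theorem Separated.succ {z : ℕ → Fin 8} {d k : ℕ} (hd : 0 < d) (hd' : d ≤ 31)
    (hr : refuteDistance d k = true) (hz : ∀ t n, Sparse (factor z t n))
    (h : Separated d z) : Separated (d + 1) fun i => z (i + 32) := by
  intro i j hij hjd he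
  beta_reduce at he
  rcases Nat.lt_succ_iff_lt_or_eq.1 (show j < (i + d) + 1 by omega) with hlt | rfl
  · exact h (i + 32) (j + 32) (by omega) (by omega) he
  have hfac : (List.range d ++ [0]).map (fun e => z (i + 32 + e)) =
      factor z (i + 32) (List.range d ++ [0]).length := by
    rw [List.length_append, List.length_range, List.length_singleton, factor_succ, List.map_append]
    simp only [List.map_cons, List.map_nil, factor, add_zero]
    rw [he, add_right_comm]
  have hnd : ((List.range d).map fun e => z (i + 32 + e)).Nodup := by
    refine List.Nodup.map_on (fun a ha b hb hab => ?_) List.nodup_range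
    rw [List.mem_range] at ha hb
    by_contra hne
    rcases lt_or_gt_of_ne hne with hlt | hlt
    · exact h _ _ (by omega) (by omega) hab
    · exact h _ _ (by omega) (by omega) hab.symm
  have hzero := refute_eq_zero hd hz h.spread (fuel := 32) hnd (p := List.range d ++ [0])
    (by simp; omega) (by simp; omega) (by simp; omega) (by omega) (.inl hfac) k
  have hrev : (List.range d ++ [0]).reverse = 0 :: rangeTo d := by simp [rangeTo_eq]
  rw [hrev, List.length_append, List.length_range, List.length_singleton] at hzero
  rw [refuteDistance, appendThen_eq, Nat.blt_eq] at hr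
  exact hr.ne' hzero

theorem sparse_shift {z : ℕ → α} (hz : ∀ t n, Sparse (factor z t n)) (k : ℕ) (t n : ℕ) :
    Sparse (factor (fun i => z (i + k)) t n) := by
  convert hz (t + k) n using 1
  simp [factor, add_right_comm]

theorem sparse_factor {z : ℕ → α}
    (hz : ∀ t l, ∀ w : List α, w <+ factor z t l → w <+ factor z (t + l) l → 5 * w.length ≤ 2 * l)
    (t n : ℕ) : Sparse (factor z t n) := by
  rintro x y hxy ⟨u, v, he⟩ l ⟨w, rfl, h₁, h₂⟩
  have hlen := congrArg List.length he
  simp only [List.length_append, factor, List.length_map, List.length_range] at hlen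
  have hx : x = factor z (t + u.length) x.length := by
    refine List.ext_getElem? fun i => ?_
    rw [getElem?_factor]
    split_ifs with hi
    · have := congrArg (·[u.length + i]?) he
      simp only [getElem?_factor] at this
      rw [if_pos (by omega)] at this
      rw [add_assoc, ← this, List.append_assoc, List.append_assoc,
        List.getElem?_append_right (by omega), List.getElem?_append_left (by simpa using hi)]
      simp
    · exact List.getElem?_eq_none (by omega)
  have hy : y = factor z (t + u.length + x.length) x.length := by
    refine List.ext_getElem? fun i => ?_
    rw [getElem?_factor]
    split_ifs with hi
    · have := congrArg (·[u.length + x.length + i]?) he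
      simp only [getElem?_factor] at this
      rw [if_pos (by omega)] at this
      rw [add_assoc, add_assoc, ← add_assoc u.length, ← this, ← List.append_assoc,
        List.getElem?_append_left (by simp; omega),
        List.getElem?_append_right (by simp)]
      simp
    · exact List.getElem?_eq_none (by omega)
  exact hz (t + u.length) x.length w (hx ▸ h₁) (hy ▸ h₂)

theorem separated_four {z : ℕ → α}
    (hz : ∀ t l, ∀ w : List α, w <+ factor z t l → w <+ factor z (t + l) l → 5 * w.length ≤ 2 * l) :
    Separated 4 z := by
  intro i j hij hj he
  obtain rfl | rfl | rfl : j = i + 1 ∨ j = i + 2 ∨ j = i + 3 := by omega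
  · simpa using hz i 1 [z i] (by simp [factor]) (by simp [factor, he])
  · simpa using hz i 2 [z i] (by simp [factor, List.range_succ])
      (by simp [factor, List.range_succ, he])
  · simpa using hz i 2 [z i] (by simp [factor, List.range_succ])
      (by simp [factor, List.range_succ, he])

theorem not_separated_nine (z : ℕ → Fin 8) : ¬ Separated 9 z := by
  intro h
  obtain ⟨a, b, hne, he⟩ := Fintype.exists_ne_map_eq_of_card_lt (fun i : Fin 9 => z i) (by simp)
  rcases lt_or_gt_of_ne hne with hlt | hlt
  · exact h a b hlt (by omega) he
  · exact h b a hlt (by omega) he.symm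

theorem refuteDistance_four : refuteDistance 4 199457405848757547923409881259758052875563342831616514050133243949254292058819286797511575227413433836746871312873464930291573709774141895045922719214491398183518605134048769237244028689506563447340914007515345382535209079600047379898227181624569113032598048764479194047569504076957236533690095918199785092211838604736189988107039513450710878805129452531167213880807117468391834560170685400962465576936263476896731121398977520078096567970090624117971110963931480395119599358190450474016179541936880257553847444514633751635482564787720842862707135805124732307267599062513025386140009000447098240298334375251378585443832870635258878484228395878282654853719383692706161739143798017612975944949527640840712771834081801075660325814220732847076945949547097774082023363427094191063402207625412819982757193357529265316524267233332529254363491696916737257472540567812796891664758307166918524115460976415514960116016341066182353061229248372925623503137567661868808660857297905524360 = true := by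
  decide +kernel

theorem refuteDistance_five : refuteDistance 5 59089419453943222203235906687068465841849243505012170352583543340333116490066945568337134783422510607755208016183601192654682007970498162743808728402521165220500374653137130338727223381661845331105360542965596 = true := by
  decide +kernel

theorem refuteDistance_six : refuteDistance 6 4123170701540 = true := by
  decide +kernel

theorem refuteDistance_seven : refuteDistance 7 1298 = true := by
  decide +kernel

theorem refuteDistance_eight : refuteDistance 8 8 = true := by
  decide +kernel

end SimilarityBound

open SimilarityBound

/-- There is no infinite word over a 8-letter alphabet with similarity coefficient at
most 0.400: every infinite word over Fin 8 has adjacent equal-length factors of some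
length ℓ ≥ 1 admitting a common subsequence of length greater than 0.400·ℓ. -/
theorem no_infinite_word_fin8_similarity_le
    (z : ℕ → Fin 8) :
    ∃ (t ℓ : ℕ), 1 ≤ ℓ ∧
      ∃ w : List (Fin 8),
        w.Sublist ((List.range ℓ).map fun i => z (t + i)) ∧
        w.Sublist ((List.range ℓ).map fun i => z (t + ℓ + i)) ∧
        (0.400 : ℝ) * ℓ < (w.length : ℝ) := by
  by_contra hcon
  push Not at hcon
  have hz : ∀ t l, ∀ w : List (Fin 8), w <+ factor z t l → w <+ factor z (t + l) l →
      5 * w.length ≤ 2 * l := by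
    intro t l w h₁ h₂
    rcases Nat.eq_zero_or_pos l with rfl | hl
    · have := h₁.length_le
      simp [factor] at this
      simp [this]
    · have := hcon t l hl w h₁ h₂
      have h' : (5 * w.length : ℝ) ≤ 2 * l := by linarith
      exact_mod_cast h'
  have hs := sparse_factor hz
  have h₅ := (separated_four hz).succ (by norm_num) (by norm_num) refuteDistance_four hs
  have h₆ := h₅.succ (by norm_num) (by norm_num) refuteDistance_five (sparse_shift hs _)
  have h₇ := h₆.succ (by norm_num) (by norm_num) refuteDistance_six
    (sparse_shift (sparse_shift hs _) _)
  have h₈ := h₇.succ (by norm_num) (by norm_num) refuteDistance_seven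
    (sparse_shift (sparse_shift (sparse_shift hs _) _) _)
  exact not_separated_nine _ (h₈.succ (by norm_num) (by norm_num) refuteDistance_eight
    (sparse_shift (sparse_shift (sparse_shift (sparse_shift hs _) _) _) _))
end
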